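/- Let d_in, d_out, n, α, β ∈ ℕ with α ≥ 3·2^p, β − α ≥ 6·2^p, and n ≥ β. Then for any (α,β)-similar X, Y ∈ 𝔽^{d_in×n} and any floating-point transformer f : 𝔽^{d_in×n} → 𝔽^{d_out×n}, the outputs f(X) and f(Y) are also (α,β)-similar. -/

import Mathlib

open scoped Classical

namespace FPT

noncomputable section

/-- Minimal exponent `𝔢_min = -2^(q-1) + 2`. -/
def emin (q : ℕ) : ℤ := -(2 ^ (q - 1) : ℤ) + 2

/-- Maximal exponent `𝔢_max = 2^(q-1) - 1`. -/
def emax (q : ℕ) : ℤ := (2 ^ (q - 1) : ℤ) - 1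

/-- The set of finite floating-point numbers with `p` mantissa bits and exponent bits `q`:
normal numbers `±(1.m₁⋯m_p)·2^e = m·2^(e-p)` with `2^p ≤ |m| ≤ 2^(p+1)-1` and
`emin ≤ e ≤ emax`, together with subnormal numbers `±(0.m₁⋯m_p)·2^emin = m·2^(emin-p)`
with `|m| ≤ 2^p - 1`. -/
def Fset (p q : ℕ) : Set ℝ :=
  {x | ∃ m e : ℤ, |m| ≤ 2 ^ (p + 1) - 1 ∧ emin q ≤ e ∧ e ≤ emax q ∧
      ((2 : ℤ) ^ p ≤ |m| ∨ e = emin q) ∧ x = (m : ℝ) * (2 : ℝ) ^ (e - (p : ℤ))}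

/-- The largest positive float `Ω = (2 - 2^(-p))·2^emax`. -/
def Omega (p q : ℕ) : ℝ := (2 - (2 : ℝ) ^ (-(p : ℤ))) * (2 : ℝ) ^ (emax q)

/-- Overflow threshold `Ω + 2^(emax - p - 1)`. -/
def thr (p q : ℕ) : ℝ := Omega p q + (2 : ℝ) ^ (emax q - (p : ℤ) - 1)

/-- `y` is a float whose last mantissa bit `m_p` is zero, i.e. `y = m·2^(e-p)` with `m` even. -/
def EvenMantissa (p q : ℕ) (y : ℝ) : Prop :=
  ∃ m e : ℤ, |m| ≤ 2 ^ (p + 1) - 1 ∧ emin q ≤ e ∧ e ≤ emax q ∧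
    ((2 : ℤ) ^ p ≤ |m| ∨ e = emin q) ∧ y = (m : ℝ) * (2 : ℝ) ^ (e - (p : ℤ)) ∧ 2 ∣ m

/-- `RoundsTo p q x y` : `y` is the rounding of `x` to the nearest float, ties to even. -/
def RoundsTo (p q : ℕ) (x y : ℝ) : Prop :=
  y ∈ Fset p q ∧ (∀ z ∈ Fset p q, |x - y| ≤ |x - z|) ∧
    ((∀ z ∈ Fset p q, |x - z| = |x - y| → z = y) ∨ EvenMantissa p q y)

/-- Extended floats `𝔽̄ = 𝔽 ∪ {-∞, +∞, NaN}` (the payload of `fin` is meant to lie in `Fset`). -/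
inductive EF where
  | fin : ℝ → EF
  | pinf : EF
  | ninf : EF
  | nan : EF

/-- Rounding `⌊·⌉ : ℝ → 𝔽̄`. -/
def rnd (p q : ℕ) (x : ℝ) : EF :=
  if thr p q ≤ x then .pinf
  else if x ≤ -thr p q then .ninf
  else .fin (Classical.epsilon (RoundsTo p q x))

/-- Floating-point addition `⊕`. -/
def fadd (p q : ℕ) : EF → EF → EF
  | .nan, _ => .nan
  | _, .nan => .nan
  | .fin x, .fin y => rnd p q (x + y)
  | .fin _, .pinf => .pinf
  | .fin _, .ninf => .ninf
  | .pinf, .fin _ => .pinf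
  | .ninf, .fin _ => .ninf
  | .pinf, .pinf => .pinf
  | .ninf, .ninf => .ninf
  | .pinf, .ninf => .nan
  | .ninf, .pinf => .nan

/-- Floating-point multiplication `⊗`. -/
def fmul (p q : ℕ) : EF → EF → EF
  | .nan, _ => .nan
  | _, .nan => .nan
  | .fin x, .fin y => rnd p q (x * y)
  | .fin x, .pinf => if 0 < x then .pinf else if x < 0 then .ninf else .nan
  | .fin x, .ninf => if 0 < x then .ninf else if x < 0 then .pinf else .nan
  | .pinf, .fin y => if 0 < y then .pinf else if y < 0 then .ninf else .nan
  | .ninf, .fin y => if 0 < y then .ninf else if y < 0 then .pinf else .nan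
  | .pinf, .pinf => .pinf
  | .ninf, .ninf => .pinf
  | .pinf, .ninf => .ninf
  | .ninf, .pinf => .ninf

/-- Floating-point subtraction `x ⊖ y = x ⊕ ((-1) ⊗ y)`. -/
def fsub (p q : ℕ) (x y : EF) : EF := fadd p q x (fmul p q (.fin (-1)) y)

/-- Floating-point division (defined for `0 ≤ x ≤ y < ∞`, `y > 0`; NaN propagates). -/
def fdiv (p q : ℕ) : EF → EF → EF
  | _, .nan => .nan
  | .nan, _ => .nan
  | .fin x, .fin y => if 0 < y then rnd p q (x / y) else .nan
  | _, _ => .nan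

/-- Correctly rounded exponential `⌊exp⌉`. -/
def fexp (p q : ℕ) : EF → EF
  | .fin x => rnd p q (Real.exp x)
  | .pinf => .pinf
  | .ninf => .fin 0
  | .nan => .nan

/-- Correctly rounded ReLU `ρ = ⌊ReLU⌉`. -/
def frelu (p q : ℕ) : EF → EF
  | .fin x => rnd p q (max x 0)
  | .pinf => .pinf
  | .ninf => .fin 0
  | .nan => .nan

/-- Left-associative floating-point sum of a list (empty sum is `0`). -/
def fsuml (p q : ℕ) : List EF → EF
  | [] => .fin 0
  | x :: xs => xs.foldl (fadd p q) x

/-- Left-associative floating-point sum `⊕_{i=1}^{n} v i` over `Fin n`. -/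
def fsum (p q : ℕ) {n : ℕ} (v : Fin n → EF) : EF := fsuml p q ((List.finRange n).map v)

/-- Matrices of extended floats. -/
abbrev Mat (a b : ℕ) := Fin a → Fin b → EF

/-- Entrywise floating-point matrix addition. -/
def madd (p q : ℕ) {a b : ℕ} (M N : Mat a b) : Mat a b := fun i j => fadd p q (M i j) (N i j)

/-- Floating-point matrix multiplication with left-associative inner sums. -/
def mmul (p q : ℕ) {a b c : ℕ} (M : Mat a b) (N : Mat b c) : Mat a c :=
  fun i k => fsum p q (fun j => fmul p q (M i j) (N j k))

/-- Maximum of two extended floats (NaN-propagating). -/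
def emax2 : EF → EF → EF
  | .nan, _ => .nan
  | _, .nan => .nan
  | .pinf, _ => .pinf
  | _, .pinf => .pinf
  | .fin x, .fin y => .fin (max x y)
  | .fin x, .ninf => .fin x
  | .ninf, y => y

/-- Maximum entry of a vector of extended floats. -/
def vmax {n : ℕ} (v : Fin n → EF) : EF := ((List.finRange n).map v).foldl emax2 .ninf

/-- Floating-point softmax `σ(x)_i = ⌊exp⌉(x_i ⊖ x_*) ⊘ (⊕_j ⌊exp⌉(x_j ⊖ x_*))`. -/
def fsoftmax (p q : ℕ) {n : ℕ} (v : Fin n → EF) : Fin n → EF := fun i =>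
  fdiv p q (fexp p q (fsub p q (v i) (vmax v)))
    (fsum p q (fun j => fexp p q (fsub p q (v j) (vmax v))))

/-- Column-wise application of the floating-point softmax. -/
def colSoftmax (p q : ℕ) {k n : ℕ} (A : Mat k n) : Mat k n :=
  fun i j => fsoftmax p q (fun i' => A i' j) i

/-- The extended float is a finite float in `𝔽`. -/
def EF.IsF (p q : ℕ) : EF → Prop
  | .fin x => x ∈ Fset p q
  | _ => False

/-- The extended float is a well-formed element of `𝔽̄`. -/
def EF.Valid (p q : ℕ) : EF → Prop
  | .fin x => x ∈ Fset p q
  | _ => True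

/-- The extended float is finite (not `±∞` or NaN). -/
def EF.Finite : EF → Prop
  | .fin _ => True
  | _ => False

/-- All entries of a vector are finite floats. -/
def VecFin (p q : ℕ) {a : ℕ} (v : Fin a → EF) : Prop := ∀ i, (v i).IsF p q

/-- All entries of a matrix are finite floats. -/
def MatFin (p q : ℕ) {a b : ℕ} (M : Mat a b) : Prop := ∀ i j, (M i j).IsF p q

/-- Embed a real matrix as a matrix of extended floats. -/
def toEF {a b : ℕ} (M : Fin a → Fin b → ℝ) : Mat a b := fun i j => .fin (M i j)

/-- Parameters of one transformer block (attention layer followed by feed-forward layer)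
with `h` heads, head dimension `m`, feed-forward width `r`, hidden dimension `d`. -/
structure Block (h m r d : ℕ) where
  WK : Fin h → Fin m → Fin d → ℝ
  WQ : Fin h → Fin m → Fin d → ℝ
  WV : Fin h → Fin m → Fin d → ℝ
  WO : Fin h → Fin d → Fin m → ℝ
  W1 : Fin r → Fin d → ℝ
  W2 : Fin d → Fin r → ℝ
  b1 : Fin r → ℝ
  b2 : Fin d → ℝ

/-- All parameters of the block are floats. -/
def Block.Valid (p q : ℕ) {h m r d : ℕ} (B : Block h m r d) : Prop :=
  (∀ i a b, B.WK i a b ∈ Fset p q) ∧ (∀ i a b, B.WQ i a b ∈ Fset p q) ∧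
    (∀ i a b, B.WV i a b ∈ Fset p q) ∧ (∀ i a b, B.WO i a b ∈ Fset p q) ∧
    (∀ a b, B.W1 a b ∈ Fset p q) ∧ (∀ a b, B.W2 a b ∈ Fset p q) ∧
    (∀ a, B.b1 a ∈ Fset p q) ∧ (∀ a, B.b2 a ∈ Fset p q)

/-- The attention layer
`AT(X) = X ⊕ (⊕_i W_i^O ⊗ ((W_i^V ⊗ X) ⊗ σ((W_i^K ⊗ X)ᵀ ⊗ (W_i^Q ⊗ X))))`. -/
def attnApply (p q : ℕ) {h m r d : ℕ} (B : Block h m r d) {n : ℕ} (X : Mat d n) : Mat d n :=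
  madd p q X (fun a b =>
    fsum p q (fun i =>
      (mmul p q (toEF (B.WO i))
        (mmul p q (mmul p q (toEF (B.WV i)) X)
          (colSoftmax p q
            (mmul p q (fun u v => mmul p q (toEF (B.WK i)) X v u)
              (mmul p q (toEF (B.WQ i)) X))))) a b))

/-- The feed-forward layer `FF(X) = X ⊕ (W₂ ⊗ ρ(W₁ ⊗ X ⊕ b₁1ᵀ) ⊕ b₂1ᵀ)`. -/
def ffApply (p q : ℕ) {h m r d : ℕ} (B : Block h m r d) {n : ℕ} (X : Mat d n) : Mat d n :=
  madd p q X
    (madd p q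
      (mmul p q (toEF B.W2)
        (fun i j => frelu p q
          ((madd p q (mmul p q (toEF B.W1) X) (fun a _ => .fin (B.b1 a))) i j)))
      (fun a _ => .fin (B.b2 a)))

/-- One transformer block: `FF ∘ AT`. -/
def Block.apply (p q : ℕ) {h m r d n : ℕ} (B : Block h m r d) (X : Mat d n) : Mat d n :=
  ffApply p q B (attnApply p q B X)

/-- Composition of a list of transformer blocks (applied from left to right). -/
def blocksApply (p q : ℕ) {h m r d n : ℕ} (L : List (Block h m r d)) (X : Mat d n) : Mat d n :=
  L.foldl (fun Y B => Block.apply p q B Y) X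

/-- `f` is a floating-point transformer:
`f(X) = W_out ⊗ g(W_in ⊗ X ⊕ b_in 1ᵀ) ⊕ b_out 1ᵀ` with `g` a nonempty composition of
transformer blocks and all parameters finite floats. -/
def IsTransformer (p q din dout n : ℕ) (f : Mat din n → Mat dout n) : Prop :=
  ∃ (h m r d : ℕ) (L : List (Block h m r d)) (Win : Fin d → Fin din → ℝ) (bin : Fin d → ℝ)
      (Wout : Fin dout → Fin d → ℝ) (bout : Fin dout → ℝ),
    0 < h ∧ 0 < m ∧ 0 < r ∧ 0 < d ∧ L ≠ [] ∧ (∀ B ∈ L, B.Valid p q) ∧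
      (∀ i j, Win i j ∈ Fset p q) ∧ (∀ i, bin i ∈ Fset p q) ∧
      (∀ i j, Wout i j ∈ Fset p q) ∧ (∀ i, bout i ∈ Fset p q) ∧
      ∀ X : Mat din n,
        f X = madd p q
          (mmul p q (toEF Wout)
            (blocksApply p q L
              (madd p q (mmul p q (toEF Win) X) (fun i _ => .fin (bin i)))))
          (fun i _ => .fin (bout i))

/-- Column permutation: column `j` of `permCols π X` is column `π j` of `X`. -/
def permCols {a n : ℕ} (π : Equiv.Perm (Fin n)) (X : Mat a n) : Mat a n := fun i j => X i (π j)

/-- The transposition `π_{(1,2)}^n` of the first two coordinates. -/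
def swap12 (n : ℕ) (hn : 2 ≤ n) : Equiv.Perm (Fin n) :=
  Equiv.swap ⟨0, by omega⟩ ⟨1, by omega⟩

/-- The columns of `X` are pairwise distinct. -/
def DistinctCols {a n : ℕ} (X : Mat a n) : Prop :=
  ∀ j k : Fin n, j ≠ k → ∃ i, X i j ≠ X i k

/-- `(α,β)`-similarity (with 1-based column index `i = j+1`). -/
def Similar {a n : ℕ} (α β : ℕ) (X Y : Mat a n) : Prop :=
  ∃ z1 z2 : Fin a → EF,
    (∀ j : Fin n, (j : ℕ) + 1 ≤ α → ∀ i, X i j = z1 i) ∧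
    (∀ j : Fin n, α < (j : ℕ) + 1 → (j : ℕ) + 1 ≤ β → ∀ i, X i j = z2 i) ∧
    (∀ j : Fin n, (j : ℕ) + 1 < α → ∀ i, Y i j = z1 i) ∧
    (∀ j : Fin n, α ≤ (j : ℕ) + 1 → (j : ℕ) + 1 ≤ β → ∀ i, Y i j = z2 i) ∧
    (∀ j : Fin n, β < (j : ℕ) + 1 → ∀ i, X i j = Y i j)

/-- The smallest float strictly greater than `x` (junk value if none exists). -/
def succF (p q : ℕ) (x : ℝ) : ℝ := sInf {y | y ∈ Fset p q ∧ x < y}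

/-- Successor on extended floats: the smallest element of `𝔽 ∪ {+∞}` strictly above. -/
def succEF (p q : ℕ) : EF → EF
  | .fin r => if ∃ y ∈ Fset p q, r < y then .fin (succF p q r) else .pinf
  | e => e

/-- Floating-point affine transformation `φ(x) = W ⊗ x ⊕ b`. -/
def affApply (p q : ℕ) {a b : ℕ} (W : Fin b → Fin a → ℝ) (c : ℝ) (v : Fin a → EF) :
    Fin b → EF :=
  fun i => fadd p q (fsum p q (fun j => fmul p q (.fin (W i j)) (v j))) (.fin c)

/-- All intermediate values of `φ(x) = W ⊗ x ⊕ b` on input `v`, including every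
left-associative partial sum of the matrix–vector product, are finite. -/
def AffIntermFin (p q : ℕ) {a b : ℕ} (W : Fin b → Fin a → ℝ) (c : ℝ) (v : Fin a → EF) : Prop :=
  ∀ i : Fin b,
    (∀ k : ℕ,
      (fsuml p q (((List.finRange a).take k).map
        (fun j => fmul p q (.fin (W i j)) (v j)))).Finite) ∧
    (affApply p q W c v i).Finite

end
end FPT

namespace FPT

noncomputable section

/-- The overflow magnitude `2^(emax+1)`, which stands in for `±∞` on the real line. -/
def overflow (q : ℕ) : ℝ := (2 : ℝ) ^ (emax q + 1)

/-- The finite floats together with `±2^(emax+1)`. -/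
def Grid (p q : ℕ) : Set ℝ := {x | x ∈ Fset p q ∨ |x| = overflow q}

/-- `y` is `m·2^(e-p)` for an even `m` of at most `p+1` bits. -/
def HasEvenMantissa (p : ℕ) (y : ℝ) : Prop :=
  ∃ m e : ℤ, |m| ≤ 2 ^ (p + 1) - 1 ∧ 2 ∣ m ∧ y = (m : ℝ) * (2 : ℝ) ^ (e - (p : ℤ))

/-- `r` is a nearest point of the grid to `x`, with ties resolved to even mantissas. -/
def NearestEven (p q : ℕ) (x r : ℝ) : Prop :=
  r ∈ Grid p q ∧ (∀ z ∈ Grid p q, |x - r| ≤ |x - z|) ∧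
    ((∀ z ∈ Grid p q, |x - z| = |x - r| → z = r) ∨ HasEvenMantissa p r)

/-- Real value of an extended float, with `±∞` sent to `±2^(emax+1)`. -/
def EF.toReal (q : ℕ) : EF → ℝ
  | .fin x => x
  | .pinf => overflow q
  | .ninf => -overflow q
  | .nan => 0

theorem neg_mem_Fset {p q : ℕ} {x : ℝ} (h : x ∈ Fset p q) : -x ∈ Fset p q := by
  obtain ⟨m, e, h1, h2, h3, h4, rfl⟩ := h
  exact ⟨-m, e, by rwa [abs_neg], h2, h3, by rwa [abs_neg], by push_cast; ring⟩

theorem EvenMantissa.neg {p q : ℕ} {x : ℝ} (h : EvenMantissa p q x) : EvenMantissa p q (-x) := by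
  obtain ⟨m, e, h1, h2, h3, h4, rfl, h5⟩ := h
  exact ⟨-m, e, by rwa [abs_neg], h2, h3, by rwa [abs_neg], by push_cast; ring,
    (dvd_neg).2 h5⟩

theorem EvenMantissa.hasEvenMantissa {p q : ℕ} {x : ℝ} (h : EvenMantissa p q x) :
    HasEvenMantissa p x := by
  obtain ⟨m, e, h1, -, -, -, h4, h5⟩ := h
  exact ⟨m, e, h1, h5, h4⟩

theorem HasEvenMantissa.neg {p : ℕ} {x : ℝ} (h : HasEvenMantissa p x) :
    HasEvenMantissa p (-x) := by
  obtain ⟨m, e, h1, h2, rfl⟩ := h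
  exact ⟨-m, e, by rwa [abs_neg], (dvd_neg).2 h2, by push_cast; ring⟩

theorem neg_mem_Grid {p q : ℕ} {x : ℝ} (h : x ∈ Grid p q) : -x ∈ Grid p q := by
  rcases h with h | h
  · exact Or.inl (neg_mem_Fset h)
  · exact Or.inr (by rwa [abs_neg])

theorem NearestEven.neg {p q : ℕ} {x r : ℝ} (h : NearestEven p q x r) :
    NearestEven p q (-x) (-r) := by
  obtain ⟨h1, h2, h3⟩ := h
  have key : ∀ z, |-x - z| = |x - -z| := fun z => by rw [← abs_neg]; congr 1; ring
  refine ⟨neg_mem_Grid h1, fun z hz => ?_, ?_⟩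
  · rw [key, key, neg_neg]; exact h2 _ (neg_mem_Grid hz)
  · rcases h3 with h3 | h3
    · refine Or.inl fun z hz hzr => ?_
      rw [key, key, neg_neg] at hzr
      rw [← h3 _ (neg_mem_Grid hz) hzr, neg_neg]
    · exact Or.inr h3.neg

theorem overflow_pos (q : ℕ) : 0 < overflow q := by unfold overflow; positivity

theorem Omega_eq (p q : ℕ) : Omega p q = overflow q - 2 * (2 : ℝ) ^ (emax q - (p : ℤ) - 1) := by
  unfold Omega overflow
  rw [zpow_sub₀ two_ne_zero, zpow_sub₀ two_ne_zero, zpow_add₀ two_ne_zero, zpow_neg]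
  field_simp

theorem thr_eq (p q : ℕ) : thr p q = overflow q - (2 : ℝ) ^ (emax q - (p : ℤ) - 1) := by
  unfold thr
  rw [Omega_eq]; ring

theorem Omega_lt_thr (p q : ℕ) : Omega p q < thr p q := by
  unfold thr
  linarith [zpow_pos (zero_lt_two' ℝ) (emax q - (p : ℤ) - 1)]

theorem thr_lt_overflow (p q : ℕ) : thr p q < overflow q := by
  rw [thr_eq]
  linarith [zpow_pos (zero_lt_two' ℝ) (emax q - (p : ℤ) - 1)]

theorem abs_le_Omega {p q : ℕ} {x : ℝ} (h : x ∈ Fset p q) : |x| ≤ Omega p q := by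
  obtain ⟨m, e, h1, h2, h3, -, rfl⟩ := h
  have h4 : (|m| : ℝ) ≤ 2 ^ (p + 1) - 1 := by exact_mod_cast h1
  have h5 : (2 : ℝ) ^ (e - (p : ℤ)) ≤ 2 ^ (emax q - (p : ℤ)) :=
    zpow_le_zpow_right₀ one_le_two (by omega)
  have h6 : (0 : ℝ) < (2 : ℝ) ^ (e - (p : ℤ)) := by positivity
  have h7 : Omega p q = (2 ^ (p + 1) - 1) * (2 : ℝ) ^ (emax q - (p : ℤ)) := by
    unfold Omega
    rw [zpow_sub₀ two_ne_zero, zpow_neg, zpow_natCast, pow_succ]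
    field_simp
  rw [abs_mul, abs_of_pos h6, h7]
  have : (1 : ℝ) ≤ 2 ^ (p + 1) := one_le_pow₀ one_le_two
  exact mul_le_mul h4 h5 h6.le (by linarith)

theorem abs_lt_overflow {p q : ℕ} {x : ℝ} (h : x ∈ Fset p q) : |x| < overflow q :=
  (abs_le_Omega h).trans_lt ((Omega_lt_thr p q).trans (thr_lt_overflow p q))

theorem overflow_mem_Grid (p q : ℕ) : overflow q ∈ Grid p q :=
  Or.inr (abs_of_pos (overflow_pos q))

theorem overflow_eq (p q : ℕ) :
    overflow q = ((2 ^ p : ℤ) : ℝ) * (2 : ℝ) ^ (emax q + 1 - (p : ℤ)) := by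
  push_cast
  rw [← zpow_natCast, ← zpow_add₀ two_ne_zero]
  unfold overflow
  congr 1; ring

theorem mem_Grid_bits (p q : ℕ) {y : ℝ} (h : y ∈ Grid p q) :
    ∃ m e : ℤ, |m| < 2 ^ (p + 1) ∧ y = (m : ℝ) * (2 : ℝ) ^ (e - (p : ℤ)) := by
  rcases h with ⟨m, e, h1, -, -, -, h⟩ | h
  · exact ⟨m, e, by omega, h⟩
  · have hlt : |(2 ^ p : ℤ)| < 2 ^ (p + 1) := by
      rw [abs_of_pos (by positivity), pow_succ]
      linarith [pow_pos (zero_lt_two' ℤ) p]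
    rcases (abs_eq (overflow_pos q).le).1 h with h | h
    · exact ⟨2 ^ p, emax q + 1, hlt, h.trans (overflow_eq p q)⟩
    · exact ⟨-2 ^ p, emax q + 1, by rwa [abs_neg], by rw [h, overflow_eq p q]; push_cast; ring⟩

/-- Grid points of magnitude at least `2^j` are integer multiples of `2^(j-p)`. -/
theorem exists_eq_mul_zpow {p q : ℕ} {y : ℝ} (hy : y ∈ Grid p q) {j : ℤ}
    (hj : (2 : ℝ) ^ j ≤ |y|) : ∃ m : ℤ, y = (m : ℝ) * (2 : ℝ) ^ (j - (p : ℤ)) := by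
  obtain ⟨m, e, hm, rfl⟩ := mem_Grid_bits p q hy
  have h6 : (0 : ℝ) < (2 : ℝ) ^ (e - (p : ℤ)) := by positivity
  have h4 : (|m| : ℝ) < 2 ^ (p + 1) := by exact_mod_cast hm
  have h5 : (2 : ℝ) ^ j < 2 ^ (e + 1) := by
    calc (2 : ℝ) ^ j ≤ |(m : ℝ)| * 2 ^ (e - (p : ℤ)) := by rwa [abs_mul, abs_of_pos h6] at hj
      _ < 2 ^ (p + 1) * 2 ^ (e - (p : ℤ)) := mul_lt_mul_of_pos_right h4 h6
      _ = 2 ^ (e + 1) := by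
        rw [← zpow_natCast, ← zpow_add₀ two_ne_zero]; congr 1; push_cast; ring
  have h7 : j < e + 1 := (zpow_lt_zpow_iff_right₀ one_lt_two).1 h5
  obtain ⟨n, hn⟩ := Int.eq_ofNat_of_zero_le (show 0 ≤ e - j by omega)
  refine ⟨m * 2 ^ n, ?_⟩
  push_cast
  rw [mul_assoc, ← zpow_natCast, ← zpow_add₀ two_ne_zero]
  congr 2; omega

theorem mul_zpow_mem_Grid_of_lt {p q : ℕ} (n : ℕ) (m : ℤ) (hm : |m| < 2 ^ (p + 1))
    (hT : |(m : ℝ) * (2 : ℝ) ^ (emin q - (p : ℤ) + n)| ≤ overflow q)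
    (hq : emin q ≤ emax q) :
    (m : ℝ) * (2 : ℝ) ^ (emin q - (p : ℤ) + n) ∈ Grid p q := by
  induction n generalizing m with
  | zero =>
    exact Or.inl ⟨m, emin q, by omega, le_rfl, hq, Or.inr rfl, by simp⟩
  | succ n ih =>
    by_cases h : (2 : ℤ) ^ p ≤ |m|
    · by_cases he : emin q + (n + 1) ≤ emax q
      · refine Or.inl ⟨m, emin q + (n + 1), by omega, by omega, he, Or.inl h, ?_⟩
        congr 2; push_cast; ring
      · refine Or.inr (le_antisymm hT ?_)
        have h1 : ((2 : ℝ) ^ p) ≤ |(m : ℝ)| := by exact_mod_cast h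
        rw [abs_mul, abs_of_pos (zpow_pos (zero_lt_two' ℝ) _), overflow_eq p q]
        push_cast
        refine mul_le_mul h1 (zpow_le_zpow_right₀ one_le_two ?_) (by positivity) (by positivity)
        omega
    · have e1 : (m : ℝ) * (2 : ℝ) ^ (emin q - (p : ℤ) + ((n + 1 : ℕ) : ℤ)) =
          ((2 * m : ℤ) : ℝ) * (2 : ℝ) ^ (emin q - (p : ℤ) + n) := by
        rw [Nat.cast_succ, ← add_assoc, zpow_add_one₀ two_ne_zero]; push_cast; ring
      rw [e1] at hT ⊢
      refine ih (2 * m) ?_ hT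
      rw [abs_mul, pow_succ, abs_of_pos (zero_lt_two' ℤ)]
      linarith

/-- Integer multiples `m·2^k` with `|m| ≤ 2^(p+1)` lie on the grid unless they overflow. -/
theorem mul_zpow_mem_Grid {p q : ℕ} (hq : emin q ≤ emax q) {m k : ℤ} (hm : |m| ≤ 2 ^ (p + 1))
    (hk : emin q - p ≤ k) (hT : |(m : ℝ) * (2 : ℝ) ^ k| ≤ overflow q) :
    (m : ℝ) * (2 : ℝ) ^ k ∈ Grid p q := by
  rcases hm.lt_or_eq with hm | hm
  · obtain ⟨n, hn⟩ := Int.eq_ofNat_of_zero_le (show 0 ≤ k - (emin q - p) by omega)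
    obtain rfl : k = emin q - p + n := by omega
    exact mul_zpow_mem_Grid_of_lt n m hm hT hq
  · obtain ⟨m', rfl⟩ : (2 : ℤ) ∣ m := by
      rw [← dvd_abs, hm]; exact dvd_pow_self 2 (by omega)
    obtain ⟨n, hn⟩ := Int.eq_ofNat_of_zero_le (show 0 ≤ k + 1 - (emin q - p) by omega)
    have e1 : ((2 * m' : ℤ) : ℝ) * (2 : ℝ) ^ k = (m' : ℝ) * (2 : ℝ) ^ (emin q - (p : ℤ) + n) := by
      rw [show emin q - (p : ℤ) + n = k + 1 by omega, zpow_add_one₀ two_ne_zero]; push_cast; ring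
    rw [e1] at hT ⊢
    refine mul_zpow_mem_Grid_of_lt n m' ?_ hT hq
    rw [abs_mul, pow_succ, abs_of_pos (zero_lt_two' ℤ)] at hm
    rw [pow_succ]
    have := pow_pos (zero_lt_two' ℤ) p
    omega

theorem finite_Fset (p q : ℕ) : (Fset p q).Finite := by
  refine (((Set.finite_Icc (-(2 ^ (p + 1) - 1) : ℤ) (2 ^ (p + 1) - 1)).prod
    (Set.finite_Icc (emin q) (emax q))).image
      fun a => (a.1 : ℝ) * (2 : ℝ) ^ (a.2 - (p : ℤ))).subset ?_
  rintro x ⟨m, e, h1, h2, h3, -, rfl⟩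
  exact ⟨(m, e), ⟨abs_le.1 h1, h2, h3⟩, rfl⟩

theorem zero_mem_Fset {p q : ℕ} (hq : emin q ≤ emax q) : (0 : ℝ) ∈ Fset p q :=
  ⟨0, emin q, by simpa using one_le_pow₀ (one_le_two : (1 : ℤ) ≤ 2), le_rfl, hq, Or.inr rfl,
    by simp⟩

/-- Of two consecutive nonnegative floats, one has an even mantissa. -/
theorem evenMantissa_or_of_nonneg {p q : ℕ} (hp : 1 ≤ p) {r z : ℝ} (hr : r ∈ Fset p q)
    (hz : z ∈ Fset p q) (h0 : 0 ≤ r) (hrz : r < z) (hgap : ∀ y ∈ Fset p q, r < y → z ≤ y) :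
    EvenMantissa p q r ∨ EvenMantissa p q z := by
  obtain ⟨m, e, h1, h2, h3, h4, rfl⟩ := id hr
  by_cases hm : 2 ∣ m
  · exact Or.inl ⟨m, e, h1, h2, h3, h4, rfl, hm⟩
  right
  have hpos : ∀ i : ℤ, (0 : ℝ) < (2 : ℝ) ^ i := fun i => by positivity
  have hm0 : 0 ≤ m := by
    have := nonneg_of_mul_nonneg_left h0 (hpos _)
    exact_mod_cast this
  have hP := pow_pos (zero_lt_two' ℤ) p
  rw [abs_of_nonneg hm0] at h1 h4
  have hlt : (m : ℝ) * 2 ^ (e - (p : ℤ)) < ((m + 1 : ℤ) : ℝ) * 2 ^ (e - (p : ℤ)) :=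
    mul_lt_mul_of_pos_right (by push_cast; linarith) (hpos _)
  have hsucc : EvenMantissa p q (((m + 1 : ℤ) : ℝ) * 2 ^ (e - (p : ℤ))) := by
    by_cases hb : m + 1 ≤ 2 ^ (p + 1) - 1
    · exact ⟨m + 1, e, by rwa [abs_of_nonneg (by omega)], h2, h3,
        by rw [abs_of_nonneg (by omega)]; omega, rfl, by omega⟩
    · have hm1 : m + 1 = 2 * 2 ^ p := by rw [pow_succ] at h1 hb; omega
      have he : e + 1 ≤ emax q := by
        by_contra he
        obtain rfl : e = emax q := by omega
        have hle := (le_abs_self z).trans (abs_le_Omega hz)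
        have : Omega p q = (m : ℝ) * 2 ^ (emax q - (p : ℤ)) := by
          rw [show m = 2 * 2 ^ p - 1 by omega]
          unfold Omega
          rw [zpow_sub₀ two_ne_zero, zpow_neg]
          push_cast
          rw [zpow_natCast]
          field_simp
        linarith
      refine ⟨2 ^ p, e + 1, ?_, by omega, he, Or.inl (le_abs_self _), ?_,
        dvd_pow_self 2 (by omega)⟩
      · rw [abs_of_pos hP, pow_succ]; omega
      · rw [hm1, show e + 1 - (p : ℤ) = e - p + 1 by ring, zpow_add_one₀ two_ne_zero]
        push_cast; ring
  have hsF : (((m + 1 : ℤ) : ℝ) * 2 ^ (e - (p : ℤ))) ∈ Fset p q := by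
    obtain ⟨a, b, c1, c2, c3, c4, c5, -⟩ := hsucc
    exact ⟨a, b, c1, c2, c3, c4, c5⟩
  rcases (hgap _ hsF hlt).eq_or_lt with heq | hzlt
  · rwa [heq]
  exfalso
  obtain ⟨m', e', g1, g2, g3, g4, rfl⟩ := hz
  by_cases hee : e ≤ e'
  · obtain ⟨n, hn⟩ := Int.eq_ofNat_of_zero_le (show 0 ≤ e' - e by omega)
    have e1 : (m' : ℝ) * 2 ^ (e' - (p : ℤ)) = ((m' * 2 ^ n : ℤ) : ℝ) * 2 ^ (e - (p : ℤ)) := by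
      push_cast
      rw [mul_assoc, ← zpow_natCast, ← zpow_add₀ two_ne_zero]
      congr 2; omega
    rw [e1] at hrz hzlt
    have a1 := lt_of_mul_lt_mul_right hrz (hpos _).le
    have a2 := lt_of_mul_lt_mul_right hzlt (hpos _).le
    have a1' : m < m' * 2 ^ n := by exact_mod_cast a1
    have a2' : m' * 2 ^ n < m + 1 := by exact_mod_cast a2
    omega
  · have hmP : 2 ^ p ≤ m := by omega
    have b1 : (2 : ℝ) ^ e ≤ m * 2 ^ (e - (p : ℤ)) := by
      have : ((2 : ℝ) ^ p) ≤ m := by exact_mod_cast hmP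
      calc (2 : ℝ) ^ e = 2 ^ p * 2 ^ (e - (p : ℤ)) := by
            rw [← zpow_natCast, ← zpow_add₀ two_ne_zero]; congr 1; ring
        _ ≤ _ := mul_le_mul_of_nonneg_right this (hpos _).le
    have hzG : (m' : ℝ) * 2 ^ (e' - (p : ℤ)) < 2 ^ (e' + 1) := by
      have : (m' : ℝ) < 2 ^ (p + 1) := by
        have : m' < 2 ^ (p + 1) := by have := le_abs_self m'; omega
        exact_mod_cast this
      calc _ < (2 : ℝ) ^ (p + 1) * 2 ^ (e' - (p : ℤ)) := mul_lt_mul_of_pos_right this (hpos _)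
        _ = _ := by
          rw [← zpow_natCast, ← zpow_add₀ two_ne_zero]; congr 1; push_cast; ring
    have b2 : (2 : ℝ) ^ (e' + 1) ≤ 2 ^ e := zpow_le_zpow_right₀ one_le_two (by omega)
    linarith

theorem evenMantissa_or {p q : ℕ} (hp : 1 ≤ p) (hq : emin q ≤ emax q) {r z : ℝ}
    (hr : r ∈ Fset p q) (hz : z ∈ Fset p q) (hrz : r < z)
    (hgap : ∀ y ∈ Fset p q, r < y → z ≤ y) :
    EvenMantissa p q r ∨ EvenMantissa p q z := by
  rcases le_or_gt 0 r with h | h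
  · exact evenMantissa_or_of_nonneg hp hr hz h hrz hgap
  · have hz0 : z ≤ 0 := hgap 0 (zero_mem_Fset hq) h
    have := evenMantissa_or_of_nonneg hp (neg_mem_Fset hz) (neg_mem_Fset hr) (by linarith)
      (by linarith) fun y hy hzy => by
        by_contra hc
        have := hgap (-y) (neg_mem_Fset hy) (by linarith)
        linarith
    rcases this with h | h
    · right; simpa using h.neg
    · left; simpa using h.neg

theorem exists_roundsTo {p q : ℕ} (hp : 1 ≤ p) (hq : emin q ≤ emax q) (x : ℝ) :
    ∃ r, RoundsTo p q x r := by
  obtain ⟨r, hr, hmin⟩ := Set.exists_min_image (Fset p q) (fun z => |x - z|) (finite_Fset p q)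
    ⟨0, zero_mem_Fset hq⟩
  by_cases hu : ∀ z ∈ Fset p q, |x - z| = |x - r| → z = r
  · exact ⟨r, hr, hmin, Or.inl hu⟩
  push Not at hu
  obtain ⟨z, hz, hzr, hne⟩ := hu
  have hmin' : ∀ y ∈ Fset p q, |x - z| ≤ |x - y| := fun y hy => hzr ▸ hmin y hy
  have key : ∀ a b, a ∈ Fset p q → b ∈ Fset p q → a < b → |x - a| = |x - b| →
      (∀ y ∈ Fset p q, |x - a| ≤ |x - y|) → EvenMantissa p q a ∨ EvenMantissa p q b := by
    intro a b ha hb hab hd hm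
    refine evenMantissa_or hp hq ha hb hab fun y hy hay => ?_
    by_contra hyb
    push Not at hyb
    have h1 := hm y hy
    rcases abs_cases (x - a) with h | h <;> rcases abs_cases (x - b) with h' | h' <;>
      rcases abs_cases (x - y) with h'' | h'' <;> linarith
  have : EvenMantissa p q r ∨ EvenMantissa p q z := by
    rcases lt_or_gt_of_ne hne with h | h
    · exact (key z r hz hr h hzr hmin').symm
    · exact key r z hr hz h hzr.symm hmin
  rcases this with h | h
  · exact ⟨r, hr, hmin, Or.inr h⟩
  · exact ⟨z, hz, hmin', Or.inr h⟩

theorem nearestEven_overflow {p q : ℕ} (hp : 1 ≤ p) {x : ℝ} (h : thr p q ≤ x) :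
    NearestEven p q x (overflow q) := by
  refine ⟨overflow_mem_Grid p q, fun z hz => ?_, Or.inr ?_⟩
  · have h1 := Omega_eq p q
    have h2 := thr_eq p q
    have hw := zpow_pos (zero_lt_two' ℝ) (emax q - (p : ℤ) - 1)
    rcases hz with hz | hz
    · have := (le_abs_self z).trans (abs_le_Omega hz)
      rw [abs_of_nonneg (show 0 ≤ x - z by linarith), abs_le]
      constructor <;> linarith
    · have := overflow_pos q
      rcases (abs_eq this.le).1 hz with rfl | rfl
      · exact le_rfl
      · have := overflow_pos q
        have h3 : 0 < thr p q := by
          have h4 : (2 : ℝ) ^ (emax q - (p : ℤ) - 1) < overflow q :=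
            zpow_lt_zpow_right₀ one_lt_two (by omega)
          linarith
        rw [abs_of_nonneg (show 0 ≤ x - -overflow q by linarith), abs_le]
        constructor <;> linarith
  · refine ⟨2 ^ p, emax q + 1, ?_, dvd_pow_self 2 (by omega), overflow_eq p q⟩
    have := pow_pos (zero_lt_two' ℤ) p
    rw [abs_of_pos this, pow_succ]; omega

theorem nearestEven_of_roundsTo {p q : ℕ} {x r : ℝ} (h : RoundsTo p q x r)
    (hx : |x| < thr p q) (hΩ : Omega p q ∈ Fset p q) : NearestEven p q x r := by
  obtain ⟨h1, h2, h3⟩ := h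
  obtain ⟨hx1, hx2⟩ := abs_lt.1 hx
  have hfar : ∀ z, |z| = overflow q → |x - r| < |x - z| := by
    intro z hz
    have e1 := Omega_eq p q
    have e2 := thr_eq p q
    have hw := zpow_pos (zero_lt_two' ℝ) (emax q - (p : ℤ) - 1)
    rcases (abs_eq (overflow_pos q).le).1 hz with rfl | rfl
    · refine (h2 _ hΩ).trans_lt ?_
      rw [abs_of_neg (show x - overflow q < 0 by linarith), abs_lt]
      constructor <;> linarith
    · refine (h2 _ (neg_mem_Fset hΩ)).trans_lt ?_
      rw [abs_of_pos (show 0 < x - -overflow q by linarith), abs_lt]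
      constructor <;> linarith
  refine ⟨Or.inl h1, fun z hz => ?_, ?_⟩
  · rcases hz with hz | hz
    · exact h2 z hz
    · exact (hfar z hz).le
  · rcases h3 with h3 | h3
    · refine Or.inl fun z hz hd => ?_
      rcases hz with hz | hz
      · exact h3 z hz hd
      · exact absurd hd (hfar z hz).ne'
    · exact Or.inr h3.hasEvenMantissa

theorem Omega_mem_Fset {p q : ℕ} (hq : emin q ≤ emax q) : Omega p q ∈ Fset p q := by
  have hP := pow_pos (zero_lt_two' ℤ) p
  refine ⟨2 ^ (p + 1) - 1, emax q, ?_, hq, le_rfl, Or.inl ?_, ?_⟩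
  · rw [abs_of_nonneg (by rw [pow_succ]; omega)]
  · rw [abs_of_nonneg (by rw [pow_succ]; omega), pow_succ]; omega
  · unfold Omega
    rw [zpow_sub₀ two_ne_zero, zpow_neg]
    push_cast
    rw [zpow_natCast, pow_succ]
    field_simp

/-- Rounding, read on the real line, is rounding to the nearest grid point. -/
theorem rnd_spec {p q : ℕ} (hp : 1 ≤ p) (hq : emin q ≤ emax q) (x : ℝ) :
    (rnd p q x).Valid p q ∧ rnd p q x ≠ .nan ∧ NearestEven p q x ((rnd p q x).toReal q) := by
  unfold rnd
  split_ifs with h1 h2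
  · exact ⟨trivial, by simp, nearestEven_overflow hp h1⟩
  · refine ⟨trivial, by simp, ?_⟩
    have h := (nearestEven_overflow hp (show thr p q ≤ -x by linarith)).neg
    rwa [neg_neg] at h
  · have h := Classical.epsilon_spec (exists_roundsTo hp hq x)
    exact ⟨h.1, by simp, nearestEven_of_roundsTo h (abs_lt.2 ⟨by linarith, by linarith⟩)
      (Omega_mem_Fset hq)⟩

theorem EF.toReal_injOn {p q : ℕ} {x y : EF} (hx : x.Valid p q) (hy : y.Valid p q)
    (hx' : x ≠ .nan) (hy' : y ≠ .nan) (h : x.toReal q = y.toReal q) : x = y := by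
  have hT := overflow_pos q
  cases x <;> cases y <;> simp only [EF.toReal, EF.Valid, ne_eq, not_true_eq_false] at * <;>
    first
    | rfl
    | exact congrArg EF.fin h
    | (have := abs_lt.1 (abs_lt_overflow hx); linarith)
    | (have := abs_lt.1 (abs_lt_overflow hy); linarith)
    | linarith

theorem NearestEven.eq_of_mem {p q : ℕ} {x r : ℝ} (h : NearestEven p q x r)
    (hx : x ∈ Grid p q) : r = x := by
  have := h.2.1 x hx
  rw [sub_self, abs_zero] at this
  linarith [abs_eq_zero.1 (le_antisymm this (abs_nonneg _))]

theorem NearestEven.le_of_le {p q : ℕ} {x r y : ℝ} (h : NearestEven p q x r)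
    (hy : y ∈ Grid p q) (hyx : y ≤ x) : y ≤ r := by
  by_contra hc
  push Not at hc
  have := h.2.1 y hy
  rw [abs_of_nonneg (by linarith : 0 ≤ x - y), abs_of_pos (by linarith : 0 < x - r)] at this
  linarith

theorem NearestEven.dyadic_le {p q : ℕ} (hq : emin q ≤ emax q) {x r : ℝ}
    (h : NearestEven p q x r) (hr : r ∈ Fset p q) {m k : ℤ} (hm : |m| ≤ 2 ^ (p + 1))
    (hk : emin q - p ≤ k) (hx : (m : ℝ) * (2 : ℝ) ^ k ≤ x) : (m : ℝ) * (2 : ℝ) ^ k ≤ r := by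
  have hrT := abs_lt.1 (abs_lt_overflow hr)
  rcases le_or_gt |(m : ℝ) * (2 : ℝ) ^ k| (overflow q) with hT | hT
  · exact h.le_of_le (mul_zpow_mem_Grid hq hm hk hT) hx
  · rcases lt_abs.1 hT with hT | hT
    · have := h.le_of_le (overflow_mem_Grid p q) (hT.le.trans hx)
      linarith
    · linarith

/-- A summation `s (k+1) = s k ⊕ b` that stays finite and changes at each of the steps
`0, …, N`. -/
structure StrictRun (p q : ℕ) (b : ℝ) (s : ℕ → ℝ) (N : ℕ) : Prop where
  mem : ∀ k ≤ N, s k ∈ Fset p q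
  near : ∀ k ≤ N, NearestEven p q (s k + b) (s (k + 1))
  ne : ∀ k ≤ N, s k ≠ s (k + 1)

theorem StrictRun.neg {p q : ℕ} {b : ℝ} {s : ℕ → ℝ} {N : ℕ} (h : StrictRun p q b s N) :
    StrictRun p q (-b) (fun k => -s k) N :=
  ⟨fun k hk => neg_mem_Fset (h.mem k hk),
    fun k hk => by rw [← neg_add]; exact (h.near k hk).neg,
    fun k hk => fun he => h.ne k hk (neg_injective he)⟩

theorem StrictRun.lt {p q : ℕ} {b : ℝ} {s : ℕ → ℝ} {N : ℕ} (h : StrictRun p q b s N)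
    (hb : 0 < b) {k : ℕ} (hk : k ≤ N) : s k < s (k + 1) :=
  lt_of_le_of_ne ((h.near k hk).le_of_le (Or.inl (h.mem k hk)) (by linarith)) (h.ne k hk)

/-- With `P = 2^p`, the integers in `[-2P, 2P]` continued by even integers on both sides. -/
def milestone (P i : ℤ) : ℤ :=
  if i < -(2 * P) then 2 * (i + P) else if i ≤ 2 * P then i else 2 * (i - P)

theorem two_pow_mul_zpow (p : ℕ) (e j : ℤ) : (2 : ℝ) ^ (p + e + j) = 2 ^ p * 2 ^ e * 2 ^ j := by
  rw [zpow_add₀ two_ne_zero, zpow_add₀ two_ne_zero, zpow_natCast]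

/-- Floats of magnitude at least `2^(p+j)·2^e` are multiples of `2^j·2^e`. -/
theorem exists_eq_mul_of_large {p q : ℕ} {y : ℝ} (hy : y ∈ Grid p q) {e j : ℤ}
    (h : (2 : ℝ) ^ p * 2 ^ e * 2 ^ j ≤ |y|) : ∃ m : ℤ, y = m * (2 ^ e * 2 ^ j) := by
  obtain ⟨m, hm⟩ := exists_eq_mul_zpow hy (j := p + e + j) (by rwa [two_pow_mul_zpow])
  refine ⟨m, hm.trans ?_⟩
  rw [← zpow_add₀ two_ne_zero]
  congr 2; ring

theorem lt_of_mul_lt_mul_cast {u : ℝ} (hu : 0 < u) {a b : ℤ} (h : (a : ℝ) * u < b * u) :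
    a < b := by
  exact_mod_cast lt_of_mul_lt_mul_right h hu.le

theorem le_of_mul_le_mul_cast {u : ℝ} (hu : 0 < u) {a b : ℤ} (h : (a : ℝ) * u ≤ b * u) :
    a ≤ b := by
  exact_mod_cast le_of_mul_le_mul_right h hu

theorem mul_le_mul_cast {u : ℝ} (hu : 0 < u) {a b : ℤ} (h : a ≤ b) : (a : ℝ) * u ≤ b * u :=
  mul_le_mul_of_nonneg_right (by exact_mod_cast h) hu.le

theorem NearestEven.milestone_succ_le {p q : ℕ} (hq : emin q ≤ emax q) {b s r : ℝ} {e : ℤ}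
    (he : emin q - p ≤ e) (hb : (2 : ℝ) ^ e ≤ b) (hs : s ∈ Fset p q) (hr : r ∈ Fset p q)
    (h : NearestEven p q (s + b) r) (hlt : s < r) {i : ℤ}
    (hi : (milestone (2 ^ p) i : ℝ) * 2 ^ e ≤ s) :
    (milestone (2 ^ p) (i + 1) : ℝ) * 2 ^ e ≤ r := by
  have hP := pow_pos (zero_lt_two' ℤ) p
  have hu : (0 : ℝ) < 2 ^ e := by positivity
  have hu2 : (0 : ℝ) < 2 ^ e * 2 ^ (1 : ℤ) := by positivity
  have hPc : (((2 : ℤ) ^ p : ℤ) : ℝ) = 2 ^ p := by push_cast; rfl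
  have hdbl : ∀ a : ℤ, ((2 * a : ℤ) : ℝ) * 2 ^ e = a * (2 ^ e * 2 ^ (1 : ℤ)) := fun a => by
    push_cast; rw [zpow_one]; ring
  rcases lt_or_ge i (-(2 * 2 ^ p)) with h1 | h1
  · have e1 : milestone (2 ^ p) (i + 1) = 2 * (i + 1 + 2 ^ p) := by
      unfold milestone; split_ifs <;> omega
    have e0 : milestone (2 ^ p) i = 2 * (i + 2 ^ p) := by unfold milestone; rw [if_pos h1]
    rw [e1, hdbl]
    rw [e0, hdbl] at hi
    by_contra hc
    push Not at hc
    have hbig : ∀ y, y ≤ r → (2 : ℝ) ^ p * 2 ^ e * 2 ^ (1 : ℤ) ≤ |y| := by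
      intro y hy
      have : ((i + 1 + 2 ^ p : ℤ) : ℝ) * (2 ^ e * 2 ^ (1 : ℤ)) ≤
          ((-(2 ^ p) : ℤ) : ℝ) * (2 ^ e * 2 ^ (1 : ℤ)) := mul_le_mul_cast hu2 (by omega)
      refine le_trans ?_ (neg_le_abs y)
      push_cast at this
      push_cast at hc
      linarith
    obtain ⟨m, hm⟩ := exists_eq_mul_of_large (Or.inl hs) (hbig s hlt.le)
    obtain ⟨m', hm'⟩ := exists_eq_mul_of_large (Or.inl hr) (hbig r le_rfl)
    rw [hm, hm'] at hlt
    rw [hm] at hi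
    rw [hm'] at hc
    have := lt_of_mul_lt_mul_cast hu2 hlt
    have := le_of_mul_le_mul_cast hu2 hi
    have := lt_of_mul_lt_mul_cast hu2 hc
    omega
  rcases lt_or_ge i (2 * 2 ^ p) with h2 | h2
  · have e1 : milestone (2 ^ p) (i + 1) = i + 1 := by unfold milestone; split_ifs <;> omega
    have e0 : milestone (2 ^ p) i = i := by unfold milestone; split_ifs <;> omega
    rw [e1]
    rw [e0] at hi
    refine h.dyadic_le hq hr ?_ he ?_
    · rw [pow_succ, abs_le]; constructor <;> omega
    · push_cast; linarith
  · have e1 : milestone (2 ^ p) (i + 1) = 2 * (i + 1 - 2 ^ p) := by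
      unfold milestone; split_ifs <;> omega
    have e0 : milestone (2 ^ p) i = 2 * (i - 2 ^ p) := by unfold milestone; split_ifs <;> omega
    rw [e1, hdbl]
    rw [e0, hdbl] at hi
    have hbig : ∀ y, s ≤ y → (2 : ℝ) ^ p * 2 ^ e * 2 ^ (1 : ℤ) ≤ |y| := by
      intro y hy
      have : ((2 ^ p : ℤ) : ℝ) * (2 ^ e * 2 ^ (1 : ℤ)) ≤
          ((i - 2 ^ p : ℤ) : ℝ) * (2 ^ e * 2 ^ (1 : ℤ)) := mul_le_mul_cast hu2 (by omega)
      refine le_trans ?_ (le_abs_self y)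
      rw [hPc] at this
      linarith
    obtain ⟨m, hm⟩ := exists_eq_mul_of_large (Or.inl hs) (hbig s le_rfl)
    obtain ⟨m', hm'⟩ := exists_eq_mul_of_large (Or.inl hr) (hbig r hlt.le)
    rw [hm, hm'] at hlt
    rw [hm] at hi
    have := lt_of_mul_lt_mul_cast hu2 hlt
    have := le_of_mul_le_mul_cast hu2 hi
    rw [hm']
    exact mul_le_mul_cast hu2 (by omega)

theorem StrictRun.milestone_le {p q : ℕ} (hq : emin q ≤ emax q) {b : ℝ} {s : ℕ → ℝ} {N : ℕ}
    (h : StrictRun p q b s N) {e : ℤ} (he : emin q - p ≤ e) (hb : (2 : ℝ) ^ e ≤ b)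
    {i : ℤ} {j : ℕ} (hi : (milestone (2 ^ p) i : ℝ) * 2 ^ e ≤ s j) (k : ℕ) (hk : j + k ≤ N) :
    (milestone (2 ^ p) (i + k) : ℝ) * 2 ^ e ≤ s (j + k) := by
  have hb0 : 0 < b := lt_of_lt_of_le (by positivity) hb
  induction k with
  | zero => simpa using hi
  | succ k ih =>
    have := (h.near (j + k) (by omega)).milestone_succ_le hq he hb (h.mem _ (by omega))
      (h.mem _ (by omega)) (h.lt hb0 (by omega)) (ih (by omega))
    rw [add_assoc] at this
    exact_mod_cast this

/-- Adding `b < 2^(e+1)` to a float of magnitude at least `2^(p+2)·2^e` has no effect. -/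
theorem NearestEven.eq_of_large {p q : ℕ} {b s r : ℝ} {e : ℤ} (hb0 : 0 < b)
    (hb : b < 2 * (2 : ℝ) ^ e) (hs : s ∈ Grid p q) (h : NearestEven p q (s + b) r)
    (hbig : 4 * 2 ^ p * (2 : ℝ) ^ e ≤ s ∨ s < -(4 * 2 ^ p * (2 : ℝ) ^ e)) : r = s := by
  have hu : (0 : ℝ) < 2 ^ e := by positivity
  have hP : (0 : ℝ) < 2 ^ p := by positivity
  have hu4 : (0 : ℝ) < 2 ^ e * 2 ^ (2 : ℤ) := by positivity
  have hsr : s ≤ r := h.le_of_le hs (by linarith)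
  have hr4 : r < s + 4 * 2 ^ e := by
    have := h.2.1 s hs
    rw [show s + b - s = b by ring, abs_of_pos hb0, abs_le] at this
    linarith [this.1]
  have e4 : (2 : ℝ) ^ p * 2 ^ e * 2 ^ (2 : ℤ) = 4 * 2 ^ p * 2 ^ e := by norm_num; ring
  have e4' : (2 : ℝ) ^ e * 2 ^ (2 : ℤ) = 4 * 2 ^ e := by norm_num; ring
  obtain ⟨m, hm⟩ := exists_eq_mul_of_large hs (e := e) (j := 2) (by
    rw [e4]
    rcases hbig with hbig | hbig
    · exact hbig.trans (le_abs_self s)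
    · exact le_trans (by linarith) (neg_le_abs s))
  obtain ⟨m', hm'⟩ := exists_eq_mul_of_large h.1 (e := e) (j := 2) (by
    rw [e4]
    rcases hbig with hbig | hbig
    · exact (hbig.trans hsr).trans (le_abs_self r)
    · refine le_trans ?_ (neg_le_abs r)
      have h1 : (m : ℝ) * (2 ^ e * 2 ^ (2 : ℤ)) < ((-2 ^ p : ℤ) : ℝ) * (2 ^ e * 2 ^ (2 : ℤ)) := by
        rw [← hm]; push_cast; linarith
      have h2 := lt_of_mul_lt_mul_cast hu4 h1
      have h3 := mul_le_mul_cast hu4 (show m + 1 ≤ -2 ^ p by omega)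
      push_cast at h3
      linarith)
  have h1 : m ≤ m' := le_of_mul_le_mul_cast hu4 (by rwa [← hm, ← hm'])
  have h2 : m' < m + 1 := lt_of_mul_lt_mul_cast hu4 (by
    push_cast; linarith)
  rw [hm, hm', show m' = m by omega]

theorem exists_zpow_le {p q : ℕ} {b : ℝ} (hb : b ∈ Fset p q) (hb0 : 0 < b) :
    ∃ e : ℤ, emin q - p ≤ e ∧ (2 : ℝ) ^ e ≤ b ∧ b < 2 * (2 : ℝ) ^ e := by
  obtain ⟨e, h1, h2⟩ := exists_mem_Ico_zpow hb0 (one_lt_two : (1 : ℝ) < 2)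
  refine ⟨e, ?_, h1, by rwa [zpow_add_one₀ two_ne_zero, mul_comm] at h2⟩
  obtain ⟨m, e', -, h3, -, -, rfl⟩ := hb
  have hw : (0 : ℝ) < 2 ^ (e' - (p : ℤ)) := by positivity
  have hm : 0 < m := by exact_mod_cast pos_of_mul_pos_left hb0 hw.le
  have : (2 : ℝ) ^ (emin q - (p : ℤ)) < 2 ^ (e + 1) := by
    refine lt_of_le_of_lt ?_ h2
    calc (2 : ℝ) ^ (emin q - (p : ℤ)) ≤ 2 ^ (e' - (p : ℤ)) :=
          zpow_le_zpow_right₀ one_le_two (by omega)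
      _ ≤ m * 2 ^ (e' - (p : ℤ)) := le_mul_of_one_le_left hw.le (by exact_mod_cast hm)
  have := (zpow_lt_zpow_iff_right₀ (one_lt_two : (1 : ℝ) < 2)).1 this
  omega

theorem StrictRun.lt_of_pos {p q : ℕ} (hq : emin q ≤ emax q) {b : ℝ} {s : ℕ → ℝ} {N : ℕ}
    (h : StrictRun p q b s N) (hb : b ∈ Fset p q) (hb0 : 0 < b) : N < 6 * 2 ^ p := by
  by_contra hN
  push Not at hN
  obtain ⟨e, he, h1, h2⟩ := exists_zpow_le hb hb0
  have hP := pow_pos (zero_lt_two' ℤ) p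
  have hs0 : (milestone (2 ^ p) (-(3 * 2 ^ p)) : ℝ) * 2 ^ e ≤ s 0 := by
    by_contra hc
    push Not at hc
    refine h.ne 0 (by omega) (NearestEven.eq_of_large hb0 h2 (Or.inl (h.mem 0 (by omega)))
      (h.near 0 (by omega)) (Or.inr ?_)).symm
    rw [show milestone (2 ^ p) (-(3 * 2 ^ p)) = -(4 * 2 ^ p) by
      unfold milestone; split_ifs <;> omega] at hc
    push_cast at hc
    linarith
  have h3 := h.milestone_le hq he h1 hs0 (6 * 2 ^ p) (by omega)
  rw [show milestone (2 ^ p) (-(3 * 2 ^ p) + ((6 * 2 ^ p : ℕ) : ℤ)) = 4 * 2 ^ p by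
    push_cast; unfold milestone; split_ifs <;> omega] at h3
  push_cast at h3
  exact h.ne _ (by omega) (NearestEven.eq_of_large hb0 h2 (Or.inl (h.mem _ (by omega)))
    (h.near _ (by omega)) (Or.inl h3)).symm

theorem StrictRun.ne_zero {p q : ℕ} {b : ℝ} {s : ℕ → ℝ} {N : ℕ}
    (h : StrictRun p q b s N) : b ≠ 0 := by
  rintro rfl
  have := (h.near 0 (by omega)).eq_of_mem (by rw [add_zero]; exact Or.inl (h.mem 0 (by omega)))
  exact h.ne 0 (by omega) (by rw [this, add_zero])

/-- Repeatedly adding `b` changes the sum at most `6·2^p` times. -/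
theorem StrictRun.length_lt {p q : ℕ} (hq : emin q ≤ emax q) {b : ℝ} {s : ℕ → ℝ} {N : ℕ}
    (h : StrictRun p q b s N) (hb : b ∈ Fset p q) : N < 6 * 2 ^ p := by
  rcases lt_or_gt_of_ne h.ne_zero with hb0 | hb0
  · exact h.neg.lt_of_pos hq (neg_mem_Fset hb) (by linarith)
  · exact h.lt_of_pos hq hb hb0

theorem NearestEven.le_dyadic {p q : ℕ} (hq : emin q ≤ emax q) {x r : ℝ}
    (h : NearestEven p q x r) (hr : r ∈ Fset p q) {m k : ℤ} (hm : |m| ≤ 2 ^ (p + 1))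
    (hk : emin q - p ≤ k) (hx : x ≤ (m : ℝ) * (2 : ℝ) ^ k) : r ≤ (m : ℝ) * (2 : ℝ) ^ k := by
  have := h.neg.dyadic_le hq (neg_mem_Fset hr) (m := -m) (by rwa [abs_neg]) hk
    (by push_cast; linarith)
  push_cast at this
  linarith

/-- `(2^p + 1)·2^(e+1)` has an odd mantissa. -/
theorem not_hasEvenMantissa {p : ℕ} (hp : 1 ≤ p) (e : ℤ) :
    ¬ HasEvenMantissa p (((2 ^ p + 1 : ℤ) : ℝ) * (2 ^ e * 2 ^ (1 : ℤ))) := by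
  rintro ⟨m, e', h1, ⟨m, rfl⟩, h3⟩
  have hP := pow_pos (zero_lt_two' ℤ) p
  rw [pow_succ] at h1
  have hm : m < 2 ^ p := by have := le_abs_self (2 * m); linarith
  have h4 : ((2 ^ p + 1 : ℤ) : ℝ) * 2 ^ (e + 1) = (m : ℝ) * 2 ^ (e' - p + 1) := by
    rw [zpow_add₀ two_ne_zero, h3, zpow_add_one₀ two_ne_zero]; push_cast; ring
  have hw : ∀ i : ℤ, (0 : ℝ) < 2 ^ i := fun i => by positivity
  rcases le_or_gt (e' - p + 1) (e + 1) with h | h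
  · have h5 : (2 : ℝ) ^ (e' - (p : ℤ) + 1) ≤ 2 ^ (e + 1) := zpow_le_zpow_right₀ one_le_two h
    have h6 : (m : ℝ) < ((2 ^ p + 1 : ℤ) : ℝ) := by exact_mod_cast (by omega : m < (2 ^ p + 1 : ℤ))
    have h7 : (0 : ℝ) < ((2 ^ p + 1 : ℤ) : ℝ) := by exact_mod_cast (by omega : (0 : ℤ) < 2 ^ p + 1)
    have h8 := mul_lt_mul_of_pos_right h6 (hw (e' - p + 1))
    have h9 := mul_le_mul_of_nonneg_left h5 h7.le
    linarith
  · obtain ⟨n, hn⟩ := Int.eq_ofNat_of_zero_le (show 0 ≤ e' - p + 1 - (e + 1) - 1 by omega)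
    rw [show e' - (p : ℤ) + 1 = ((n + 1 : ℕ) : ℤ) + (e + 1) by push_cast; omega,
      zpow_add₀ two_ne_zero (((n + 1 : ℕ) : ℤ)), ← mul_assoc, zpow_natCast] at h4
    have h5 := mul_right_cancel₀ (hw (e + 1)).ne' h4
    have h6 : (2 ^ p + 1 : ℤ) = m * 2 ^ (n + 1) := by exact_mod_cast h5
    have h7 : (2 : ℤ) ∣ 2 ^ p + 1 := h6 ▸ Dvd.dvd.mul_left (dvd_pow_self 2 (by omega)) m
    have h8 : (2 : ℤ) ∣ 2 ^ p := dvd_pow_self 2 (by omega)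
    omega

/-- Summing a power of two from `0` stagnates, by ties-to-even, at `2^(p+1)` times the summand. -/
theorem StrictRun.lt_of_zpow {p q : ℕ} (hp : 1 ≤ p) (hq : emin q ≤ emax q) {s : ℕ → ℝ} {N : ℕ}
    {e : ℤ} (he : emin q - p ≤ e) (h : StrictRun p q (2 ^ e) s N) (h0 : s 0 = 0) :
    N < 2 * 2 ^ p := by
  by_contra hN
  push Not at hN
  have hu : (0 : ℝ) < 2 ^ e := by positivity
  have hu2 : (0 : ℝ) < 2 ^ e * 2 ^ (1 : ℤ) := by positivity
  have hP := pow_pos (zero_lt_two' ℤ) p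
  have hup : ∀ k : ℕ, k ≤ 2 * 2 ^ p → s k ≤ ((k : ℤ) : ℝ) * 2 ^ e := by
    intro k hk
    induction k with
    | zero => simp [h0]
    | succ k ih =>
      refine (h.near k (by omega)).le_dyadic hq (h.mem _ (by omega)) ?_ he ?_
      · have : ((k + 1 : ℕ) : ℤ) ≤ 2 * 2 ^ p := by exact_mod_cast hk
        rw [abs_of_nonneg (by positivity), pow_succ]; omega
      · have := ih (by omega)
        push_cast at this ⊢
        linarith
  have hlow := h.milestone_le hq he le_rfl (i := 0) (j := 0)
    (by rw [show milestone (2 ^ p) 0 = 0 by unfold milestone; split_ifs <;> omega]; simp [h0])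
    (2 * 2 ^ p) (by omega)
  rw [show milestone (2 ^ p) (0 + ((2 * 2 ^ p : ℕ) : ℤ)) = 2 * 2 ^ p by
    push_cast; unfold milestone; split_ifs <;> omega, zero_add] at hlow
  have hup' := hup (2 * 2 ^ p) le_rfl
  have hs : s (2 * 2 ^ p) = 2 ^ p * (2 ^ e * 2 ^ (1 : ℤ)) := by
    push_cast at hlow hup'
    rw [zpow_one]
    linarith
  have hlt := h.lt hu (k := 2 * 2 ^ p) (by omega)
  obtain ⟨hG, hnear, htie⟩ := h.near (2 * 2 ^ p) (by omega)
  set r := s (2 * 2 ^ p + 1)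
  have hd : |s (2 * 2 ^ p) + 2 ^ e - s (2 * 2 ^ p)| = 2 ^ e := by
    rw [add_sub_cancel_left, abs_of_pos hu]
  have hsG : s (2 * 2 ^ p) ∈ Grid p q := Or.inl (h.mem _ (by omega))
  have hle := hnear _ hsG
  rw [hd] at hle
  obtain ⟨m, hm⟩ := exists_eq_mul_of_large hG (e := e) (j := 1) (by
    rw [mul_assoc, ← hs]; exact hlt.le.trans (le_abs_self r))
  have h1 : (2 : ℤ) ^ p < m := lt_of_mul_lt_mul_cast hu2 (by
    rw [← hm]; push_cast; rw [← hs]; exact hlt)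
  have h2 : m ≤ 2 ^ p + 1 := le_of_mul_le_mul_cast hu2 (by
    rw [← hm]; push_cast; rw [add_mul, ← hs, zpow_one]; linarith [(abs_le.1 hle).1])
  have h3 : m = 2 ^ p + 1 := by omega
  rw [h3] at hm
  have hr' : r = s (2 * 2 ^ p) + 2 * 2 ^ e := by
    rw [hm, hs]; push_cast; rw [zpow_one]; ring
  rcases htie with htie | htie
  · refine hlt.ne (htie _ hsG ?_)
    rw [hd, hr', show s (2 * 2 ^ p) + (2 : ℝ) ^ e - (s (2 * 2 ^ p) + 2 * 2 ^ e) = -2 ^ e by ring,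
      abs_neg, abs_of_pos hu]
  · rw [hm] at htie
    exact not_hasEvenMantissa hp e htie

/-- A bound `K·2^e + 2^(e-f)` on the exact sum survives rounding while it is representable. -/
theorem NearestEven.add_ulp_le {p q : ℕ} (hq : emin q ≤ emax q) {x r : ℝ}
    (h : NearestEven p q x r) (hr : r ∈ Fset p q) {K f : ℕ} {e : ℤ} (hf : emin q - p ≤ e - f)
    (hK : K * 2 ^ f + 1 ≤ 2 ^ (p + 1)) (hx : (K : ℝ) * 2 ^ e + 2 ^ (e - f) ≤ x) :
    (K : ℝ) * 2 ^ e + 2 ^ (e - f) ≤ r := by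
  have e1 : (K : ℝ) * 2 ^ e + 2 ^ (e - f) = ((K * 2 ^ f + 1 : ℤ) : ℝ) * 2 ^ (e - f) := by
    have : (2 : ℝ) ^ e = 2 ^ f * 2 ^ (e - f) := by
      rw [← zpow_natCast, ← zpow_add₀ two_ne_zero]; congr 1; ring
    push_cast
    nth_rewrite 1 [this]
    ring
  rw [e1] at hx ⊢
  refine h.dyadic_le hq hr ?_ hf hx
  rw [abs_of_nonneg (by positivity)]
  exact_mod_cast hK

/-- Crossing into a coarser binade, a sum above the midpoint is rounded up. -/
theorem NearestEven.carry_le {p q : ℕ} (hq : emin q ≤ emax q) {x r : ℝ}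
    (h : NearestEven p q x r) (hr : r ∈ Fset p q) {K f : ℕ} {e : ℤ} (hf : emin q - p ≤ e - f)
    (hK : K * 2 ^ f = 2 ^ p) (hx : (K : ℝ) * 2 ^ e + 2 ^ (e - f - 1) < x) :
    (K : ℝ) * 2 ^ e + 2 ^ (e - f) ≤ r := by
  set w : ℝ := 2 ^ (e - (f : ℤ)) with hw
  have hw0 : 0 < w := by positivity
  have hue : (K : ℝ) * 2 ^ e = ((2 ^ p : ℤ) : ℝ) * w := by
    have h1 : (2 : ℝ) ^ e = 2 ^ f * w := by
      rw [hw, ← zpow_natCast, ← zpow_add₀ two_ne_zero]; congr 1; ring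
    have h2 : (K : ℝ) * 2 ^ f = 2 ^ p := by exact_mod_cast hK
    rw [h1, ← mul_assoc, h2]; push_cast; ring
  have hhalf : (2 : ℝ) ^ (e - f - 1) = w / 2 := by rw [zpow_sub_one₀ two_ne_zero, hw]; ring
  have hP := pow_pos (zero_lt_two' ℤ) p
  rw [hhalf, hue] at hx
  rw [hue]
  have hyw : ((2 ^ p : ℤ) : ℝ) * w + w = ((2 ^ p + 1 : ℤ) : ℝ) * w := by push_cast; ring
  rw [hyw]
  have hm : |(2 ^ p + 1 : ℤ)| ≤ 2 ^ (p + 1) := by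
    rw [abs_of_pos (by omega), pow_succ]; omega
  by_contra hc
  push Not at hc
  have hz : ((2 ^ p : ℤ) : ℝ) * w ≤ r :=
    h.dyadic_le hq hr (by rw [abs_of_pos hP, pow_succ]; omega) hf (by linarith)
  have hmul : ∀ y ∈ Grid p q, ((2 ^ p : ℤ) : ℝ) * w ≤ y → ∃ m : ℤ, y = m * w := by
    intro y hy hzy
    obtain ⟨m, hm⟩ := exists_eq_mul_zpow hy (j := e - f + p) (by
      rw [zpow_add₀ two_ne_zero, zpow_natCast, ← hw]
      push_cast at hzy
      linarith [le_abs_self y])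
    exact ⟨m, by rw [hm, hw]; congr 2; ring⟩
  obtain ⟨m, hmr⟩ := hmul r (Or.inl hr) hz
  have hmeq : m = 2 ^ p := by
    have h1 : (2 : ℤ) ^ p ≤ m := le_of_mul_le_mul_cast hw0 (by rwa [← hmr])
    have h2 : m < 2 ^ p + 1 := lt_of_mul_lt_mul_cast hw0 (by rwa [← hmr])
    omega
  have hyG : ((2 ^ p + 1 : ℤ) : ℝ) * w ∈ Grid p q := by
    refine mul_zpow_mem_Grid hq hm hf ?_
    rw [abs_of_pos (mul_pos (by exact_mod_cast (by omega : (0 : ℤ) < 2 ^ p + 1)) hw0)]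
    by_contra hT
    push Not at hT
    have hrT := (abs_lt.1 (abs_lt_overflow hr)).2
    obtain ⟨t, ht⟩ := hmul _ (overflow_mem_Grid p q) (hz.trans hrT.le)
    rw [ht] at hT hrT
    rw [hmr] at hrT
    have := lt_of_mul_lt_mul_cast hw0 hT
    have := lt_of_mul_lt_mul_cast hw0 hrT
    omega
  have hxy : x < ((2 ^ p + 1 : ℤ) : ℝ) * w := by
    by_contra hxy
    exact absurd (h.le_of_le hyG (not_lt.1 hxy)) (not_le.2 hc)
  have := h.2.1 _ hyG
  rw [hmr, hmeq, abs_of_pos (by linarith), abs_of_neg (by linarith)] at this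
  linarith

theorem exists_eq_mul_min_ulp {p q : ℕ} {b : ℝ} (hb : b ∈ Fset p q) :
    ∃ m : ℤ, b = m * (2 : ℝ) ^ (emin q - (p : ℤ)) := by
  obtain ⟨m, e, -, h2, -, -, rfl⟩ := hb
  obtain ⟨n, hn⟩ := Int.eq_ofNat_of_zero_le (show 0 ≤ e - emin q by omega)
  refine ⟨m * 2 ^ n, ?_⟩
  push_cast
  rw [mul_assoc, ← zpow_natCast, ← zpow_add₀ two_ne_zero]
  congr 2; omega

/-- A float strictly above `2^e` exceeds it by one unit in the last place. -/
theorem zpow_add_ulp_le {p q g : ℕ} {b : ℝ} {e : ℤ} (hb : b ∈ Fset p q)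
    (hlt : (2 : ℝ) ^ e < b) (hg : e - g = emin q - p) :
    (2 : ℝ) ^ e + 2 ^ (e - (min p g : ℕ)) ≤ b := by
  obtain ⟨m, hm⟩ : ∃ m : ℤ, b = m * (2 : ℝ) ^ (e - (min p g : ℕ)) := by
    rcases min_choice p g with h | h
    · rw [h]; exact exists_eq_mul_zpow (Or.inl hb) (hlt.le.trans (le_abs_self b))
    · rw [h, hg]; exact exists_eq_mul_min_ulp hb
  set f := min p g
  have hw : (0 : ℝ) < 2 ^ (e - (f : ℤ)) := by positivity
  have h1 : (2 : ℝ) ^ e = ((2 ^ f : ℤ) : ℝ) * 2 ^ (e - (f : ℤ)) := by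
    push_cast
    rw [← zpow_natCast, ← zpow_add₀ two_ne_zero]; congr 1; ring
  rw [hm, h1] at hlt
  have h2 := mul_le_mul_cast hw (Int.add_one_le_iff.2 (lt_of_mul_lt_mul_cast hw hlt))
  rw [hm, h1]
  push_cast at h2 ⊢
  linarith

/-- After `2^j` summands `b > 2^e` the sum exceeds `2^j·2^e` by one unit in the last place. -/
theorem StrictRun.two_pow_add_ulp_le {p q : ℕ} (hq : emin q ≤ emax q) {b : ℝ} {s : ℕ → ℝ}
    {N g : ℕ} {e : ℤ} (h : StrictRun p q b s N) (hb : b ∈ Fset p q) (hlt : (2 : ℝ) ^ e < b)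
    (hg : e - g = emin q - p) (h0 : s 0 = 0) (hN : 2 ^ p ≤ N) (j : ℕ) (hj : j ≤ p) :
    ((2 ^ j : ℕ) : ℝ) * 2 ^ e + 2 ^ (e - (min (p - j) g : ℕ)) ≤ s (2 ^ j) := by
  induction j with
  | zero =>
    have h1 : s 1 = b := by
      have := (h.near 0 (by omega)).eq_of_mem (by rw [h0, zero_add]; exact Or.inl hb)
      simpa [h0] using this
    simpa [h1] using zpow_add_ulp_le hb hlt hg
  | succ j ih =>
    have ih := ih (by omega)
    have hjP : 2 ^ (j + 1) ≤ 2 ^ p := Nat.pow_le_pow_right (by omega) hj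
    have hj0 : 0 < 2 ^ j := by positivity
    rw [pow_succ] at hjP ⊢
    have hinner : ∀ i < 2 ^ j,
        ((2 ^ j + i : ℕ) : ℝ) * 2 ^ e + 2 ^ (e - (min (p - j) g : ℕ)) ≤ s (2 ^ j + i) := by
      intro i hi
      induction i with
      | zero => simpa using ih
      | succ i ihi =>
        refine (h.near (2 ^ j + i) (by omega)).add_ulp_le hq (h.mem _ (by omega)) (by omega) ?_ ?_
        · have h1 : 2 ^ (j + 1) * 2 ^ min (p - j) g ≤ 2 ^ (p + 1) := by
            rw [← pow_add]; exact Nat.pow_le_pow_right (by omega) (by omega)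
          have h2 : 0 < 2 ^ min (p - j) g := by positivity
          have h3 : (2 ^ j + (i + 1) + 1) * 2 ^ min (p - j) g ≤ 2 ^ (j + 1) * 2 ^ min (p - j) g :=
            Nat.mul_le_mul_right _ (by rw [pow_succ]; omega)
          rw [add_mul _ 1] at h3
          omega
        · have := ihi (by omega)
          push_cast at this ⊢
          linarith
    have hlast := hinner (2 ^ j - 1) (by omega)
    have hnear := h.near (2 ^ j + (2 ^ j - 1)) (by omega)
    have hidx : 2 ^ j + (2 ^ j - 1) + 1 = 2 ^ j * 2 := by omega
    have hcast : ((2 ^ j + (2 ^ j - 1) : ℕ) : ℝ) = ((2 ^ j * 2 : ℕ) : ℝ) - 1 := by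
      rw [← hidx]; push_cast; ring
    rw [hidx] at hnear
    rw [hcast] at hlast
    rcases Nat.lt_or_ge g (p - j) with hgj | hgj
    · rw [show min (p - j) g = g by omega] at hlast
      rw [show min (p - (j + 1)) g = g by omega]
      refine hnear.add_ulp_le hq (h.mem _ (by omega)) (by omega) ?_ (by linarith)
      have h1 : 2 ^ (j + 1) * 2 ^ g ≤ 2 ^ p := by
        rw [← pow_add]; exact Nat.pow_le_pow_right (by omega) (by omega)
      have h2 : 0 < 2 ^ p := by positivity
      rw [pow_succ] at h1
      rw [pow_succ]; omega
    · rw [show min (p - j) g = p - j by omega] at hlast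
      rw [show min (p - (j + 1)) g = p - (j + 1) by omega]
      refine hnear.carry_le hq (h.mem _ (by omega)) (by omega) ?_ ?_
      · rw [← pow_succ, ← pow_add]; congr 1; omega
      · rw [show e - ((p - (j + 1) : ℕ) : ℤ) - 1 = e - ((p - j : ℕ) : ℤ) by omega]
        linarith

theorem StrictRun.lt_of_pos_of_zero {p q : ℕ} (hp : 1 ≤ p) (hq : emin q ≤ emax q) {b : ℝ}
    {s : ℕ → ℝ} {N : ℕ} (h : StrictRun p q b s N) (hb : b ∈ Fset p q) (hb0 : 0 < b)
    (h0 : s 0 = 0) : N + 1 < 3 * 2 ^ p := by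
  obtain ⟨e, he, h1, h2⟩ := exists_zpow_le hb hb0
  have hP := pow_pos (zero_lt_two' ℤ) p
  have hP2 : 2 ^ 1 ≤ 2 ^ p := Nat.pow_le_pow_right (by omega) hp
  rcases h1.eq_or_lt with heq | hlt
  · rw [← heq] at h
    have := h.lt_of_zpow hp hq he h0
    omega
  by_contra hN
  push Not at hN
  obtain ⟨g, hg⟩ := Int.eq_ofNat_of_zero_le (show 0 ≤ e - (emin q - p) by omega)
  have h3 := h.two_pow_add_ulp_le hq hb hlt (g := g) (by omega) h0 (by omega) p le_rfl
  rw [Nat.sub_self, Nat.zero_min, Nat.cast_zero, sub_zero] at h3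
  have h4 : (milestone (2 ^ p) (2 ^ p + 1) : ℝ) * 2 ^ e ≤ s (2 ^ p) := by
    rw [show milestone (2 ^ p) (2 ^ p + 1) = 2 ^ p + 1 by unfold milestone; split_ifs <;> omega]
    push_cast at h3 ⊢
    linarith
  have h5 := h.milestone_le hq he h1 h4 (2 * 2 ^ p - 1) (by omega)
  rw [show milestone (2 ^ p) (2 ^ p + 1 + ((2 * 2 ^ p - 1 : ℕ) : ℤ)) = 4 * 2 ^ p by
    push_cast [show 1 ≤ 2 * 2 ^ p by omega]; unfold milestone; split_ifs <;> omega] at h5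
  push_cast at h5
  exact h.ne _ (by omega) (NearestEven.eq_of_large hb0 h2 (Or.inl (h.mem _ (by omega)))
    (h.near _ (by omega)) (Or.inl h5)).symm

/-- Repeatedly adding `b` to `0` changes the sum at most `3·2^p - 1` times. -/
theorem StrictRun.length_lt_of_zero {p q : ℕ} (hp : 1 ≤ p) (hq : emin q ≤ emax q) {b : ℝ}
    {s : ℕ → ℝ} {N : ℕ} (h : StrictRun p q b s N) (hb : b ∈ Fset p q) (h0 : s 0 = 0) :
    N + 1 < 3 * 2 ^ p := by
  rcases lt_or_gt_of_ne h.ne_zero with hb0 | hb0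
  · exact h.neg.lt_of_pos_of_zero hp hq (neg_mem_Fset hb) (by linarith) (by simp [h0])
  · exact h.lt_of_pos_of_zero hp hq hb hb0 h0

theorem valid_zero {p q : ℕ} (hq : emin q ≤ emax q) : (EF.fin 0).Valid p q :=
  zero_mem_Fset hq

theorem valid_fadd {p q : ℕ} (hp : 1 ≤ p) (hq : emin q ≤ emax q) (x y : EF) :
    (fadd p q x y).Valid p q := by
  cases x <;> cases y <;> first | exact trivial | exact (rnd_spec hp hq _).1

theorem valid_fmul {p q : ℕ} (hp : 1 ≤ p) (hq : emin q ≤ emax q) (x y : EF) :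
    (fmul p q x y).Valid p q := by
  cases x <;> cases y <;> simp only [fmul] <;>
    first
    | exact trivial
    | exact (rnd_spec hp hq _).1
    | (split_ifs <;> exact trivial)

theorem valid_fexp {p q : ℕ} (hp : 1 ≤ p) (hq : emin q ≤ emax q) (x : EF) :
    (fexp p q x).Valid p q := by
  cases x <;> first | exact trivial | exact zero_mem_Fset hq | exact (rnd_spec hp hq _).1

theorem iterate_succ_eq_of_le {α : Type*} {f : α → α} {x : α} {k N : ℕ}
    (h : f^[k + 1] x = f^[k] x) (hk : k ≤ N) : f^[N + 1] x = f^[N] x := by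
  obtain ⟨m, rfl⟩ := Nat.exists_eq_add_of_le' hk
  rw [add_assoc, Function.iterate_add_apply, h, ← Function.iterate_add_apply]

theorem valid_fadd_iterate {p q : ℕ} (hp : 1 ≤ p) (hq : emin q ≤ emax q) {x : EF}
    (hx : x.Valid p q) (b : EF) (k : ℕ) : ((fun s => fadd p q s b)^[k] x).Valid p q := by
  cases k with
  | zero => exact hx
  | succ k => rw [Function.iterate_succ_apply']; exact valid_fadd hp hq _ _

/-- As long as the iterated sum keeps changing, it is a strict run of finite floats. -/
theorem strictRun_of_iterate_ne {p q : ℕ} (hp : 1 ≤ p) (hq : emin q ≤ emax q) {x : EF}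
    (hx : x.Valid p q) {b : ℝ} {N : ℕ}
    (h : (fun s => fadd p q s (.fin b))^[N + 1] x ≠ (fun s => fadd p q s (.fin b))^[N] x) :
    StrictRun p q b (fun k => ((fun s => fadd p q s (.fin b))^[k] x).toReal q) N := by
  have hne : ∀ k ≤ N, (fun s => fadd p q s (.fin b))^[k + 1] x ≠
      (fun s => fadd p q s (.fin b))^[k] x := fun k hk hk' => h (iterate_succ_eq_of_le hk' hk)
  have key : ∀ k ≤ N, ∃ y ∈ Fset p q, (fun s => fadd p q s (.fin b))^[k] x = .fin y ∧
      (fun s => fadd p q s (.fin b))^[k + 1] x = rnd p q (y + b) := by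
    intro k hk
    have hv := valid_fadd_iterate hp hq hx (.fin b) k
    have hk' := hne k hk
    rw [Function.iterate_succ_apply'] at hk' ⊢
    generalize (fun s => fadd p q s (.fin b))^[k] x = z at hv hk' ⊢
    cases z with
    | fin y => exact ⟨y, hv, rfl, rfl⟩
    | pinf => exact absurd rfl hk'
    | ninf => exact absurd rfl hk'
    | nan => exact absurd rfl hk'
  refine ⟨fun k hk => ?_, fun k hk => ?_, fun k hk => ?_⟩
  · obtain ⟨y, hy, h1, -⟩ := key k hk
    simpa only [h1, EF.toReal] using hy
  · obtain ⟨y, hy, h1, h2⟩ := key k hk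
    simpa only [h1, h2, EF.toReal] using (rnd_spec hp hq (y + b)).2.2
  · obtain ⟨y, hy, h1, h2⟩ := key k hk
    refine fun he => hne k hk (EF.toReal_injOn (valid_fadd_iterate hp hq hx _ _)
      (valid_fadd_iterate hp hq hx _ _) ?_ ?_ he.symm)
    · rw [h2]; exact (rnd_spec hp hq _).2.1
    · rw [h1]; simp

theorem fadd_fadd_of_not_finite {p q : ℕ} {b : EF} (hb : ¬ b.Finite) (x : EF) :
    fadd p q (fadd p q x b) b = fadd p q x b := by
  cases b with
  | fin b => exact absurd trivial hb
  | pinf => cases x <;> rfl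
  | ninf => cases x <;> rfl
  | nan => cases x <;> rfl

theorem fadd_iterate_stable {p q : ℕ} (hp : 1 ≤ p) (hq : emin q ≤ emax q) {x b : EF}
    (hx : x.Valid p q) (hb : b.Valid p q) {N : ℕ} (hN : 6 * 2 ^ p ≤ N) :
    (fun s => fadd p q s b)^[N + 1] x = (fun s => fadd p q s b)^[N] x := by
  by_cases hf : b.Finite
  · cases b with
    | fin b =>
      by_contra h
      have := (strictRun_of_iterate_ne hp hq hx h).length_lt hq hb
      omega
    | _ => exact absurd hf id
  · have := pow_pos (zero_lt_two' ℕ) p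
    exact iterate_succ_eq_of_le (k := 1) (fadd_fadd_of_not_finite hf x) (by omega)

theorem fadd_iterate_zero_stable {p q : ℕ} (hp : 1 ≤ p) (hq : emin q ≤ emax q) {b : EF}
    (hb : b.Valid p q) {N : ℕ} (hN : 3 * 2 ^ p ≤ N + 1) :
    (fun s => fadd p q s b)^[N + 1] (.fin 0) = (fun s => fadd p q s b)^[N] (.fin 0) := by
  by_cases hf : b.Finite
  · cases b with
    | fin b =>
      by_contra h
      have := (strictRun_of_iterate_ne hp hq (valid_zero hq) h).length_lt_of_zero hp hq hb rfl
      omega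
    | _ => exact absurd hf id
  · have := pow_pos (zero_lt_two' ℕ) p
    exact iterate_succ_eq_of_le (k := 1) (fadd_fadd_of_not_finite hf _) (by omega)

theorem fadd_zero_left {p q : ℕ} (hp : 1 ≤ p) (hq : emin q ≤ emax q) {x : EF}
    (hx : x.Valid p q) : fadd p q (.fin 0) x = x := by
  cases x with
  | fin x =>
    have h := rnd_spec hp hq (p := p) (0 + x)
    refine EF.toReal_injOn h.1 hx h.2.1 (by simp) ?_
    have := h.2.2.eq_of_mem (by rw [zero_add]; exact Or.inl hx)
    simpa [fadd, EF.toReal] using this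
  | _ => rfl

theorem fsuml_eq_foldl {p q : ℕ} (hp : 1 ≤ p) (hq : emin q ≤ emax q) (l : List EF)
    (hl : ∀ x ∈ l, x.Valid p q) : fsuml p q l = l.foldl (fadd p q) (.fin 0) := by
  cases l with
  | nil => rfl
  | cons x l => rw [List.foldl_cons, fadd_zero_left hp hq (hl x (by simp))]; rfl

theorem foldl_replicate_eq_iterate {α β : Type*} (f : β → α → β) (a : α) (n : ℕ) (x : β) :
    (List.replicate n a).foldl f x = (fun s => f s a)^[n] x := by
  induction n generalizing x with
  | zero => rfl
  | succ n ih => rw [List.replicate_succ, List.foldl_cons, ih, Function.iterate_succ_apply]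

/-- Moving the boundary between two constant blocks by one does not change a left fold whose
iterates have stabilized. -/
theorem foldl_shift {α β : Type*} {f : β → α → β} {a b : α} {x : β} {k m : ℕ} {R : List α}
    (ha : (fun s => f s a)^[k + 1] x = (fun s => f s a)^[k] x)
    (hb : (fun s => f s b)^[m + 1] ((fun s => f s a)^[k] x) =
      (fun s => f s b)^[m] ((fun s => f s a)^[k] x)) :
    (List.replicate (k + 1) a ++ (List.replicate m b ++ R)).foldl f x =
      (List.replicate k a ++ (List.replicate (m + 1) b ++ R)).foldl f x := by
  simp only [List.foldl_append, foldl_replicate_eq_iterate, ha, hb]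

theorem fsuml_shift {p q : ℕ} (hp : 1 ≤ p) (hq : emin q ≤ emax q) {a b : EF} {k m : ℕ}
    {R : List EF} (ha : a.Valid p q) (hb : b.Valid p q) (hR : ∀ x ∈ R, x.Valid p q)
    (hk : 3 * 2 ^ p ≤ k + 1) (hm : 6 * 2 ^ p ≤ m) :
    fsuml p q (List.replicate (k + 1) a ++ (List.replicate m b ++ R)) =
      fsuml p q (List.replicate k a ++ (List.replicate (m + 1) b ++ R)) := by
  have hv : ∀ k m, ∀ x ∈ List.replicate k a ++ (List.replicate m b ++ R), x.Valid p q := by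
    intro k m x hx
    simp only [List.mem_append, List.mem_replicate] at hx
    rcases hx with ⟨-, rfl⟩ | ⟨-, rfl⟩ | hx
    · exact ha
    · exact hb
    · exact hR x hx
  rw [fsuml_eq_foldl hp hq _ (hv _ _), fsuml_eq_foldl hp hq _ (hv _ _)]
  exact foldl_shift (fadd_iterate_zero_stable hp hq ha hk)
    (fadd_iterate_stable hp hq (valid_fadd_iterate hp hq (valid_zero hq) _ _) hb hm)

theorem emax2_emax2 (x a : EF) : emax2 (emax2 x a) a = emax2 x a := by
  cases a <;> cases x <;> simp [emax2]

theorem foldl_emax2_shift {a b : EF} {k m : ℕ} {R : List EF} (hk : 1 ≤ k) (hm : 1 ≤ m) (x : EF) :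
    (List.replicate (k + 1) a ++ (List.replicate m b ++ R)).foldl emax2 x =
      (List.replicate k a ++ (List.replicate (m + 1) b ++ R)).foldl emax2 x :=
  foldl_shift (iterate_succ_eq_of_le (k := 1) (emax2_emax2 _ _) hk)
    (iterate_succ_eq_of_le (k := 1) (emax2_emax2 _ _) hm)

/-- The list of columns of a matrix. -/
def cols {a n : ℕ} (X : Mat a n) : List (Fin a → EF) :=
  (List.finRange n).map fun j i => X i j

/-- Two matrices are indistinguishable for position-independent sums and maxima over columns. -/
def SameSums (p q : ℕ) {a n : ℕ} (X Y : Mat a n) : Prop :=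
  (∀ g : (Fin a → EF) → EF, (∀ z, (g z).Valid p q) →
    fsum p q (fun j => g fun i => X i j) = fsum p q (fun j => g fun i => Y i j)) ∧
  ∀ g : (Fin a → EF) → EF, vmax (fun j => g fun i => X i j) = vmax (fun j => g fun i => Y i j)

theorem Similar.exists_cols {a n α β : ℕ} {X Y : Mat a n} (hα : 1 ≤ α) (hαβ : α ≤ β) (hn : β ≤ n)
    (h : Similar α β X Y) : ∃ (z₁ z₂ : Fin a → EF) (R : List (Fin a → EF)),
      cols X = List.replicate (α - 1 + 1) z₁ ++ (List.replicate (β - α) z₂ ++ R) ∧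
      cols Y = List.replicate (α - 1) z₁ ++ (List.replicate (β - α + 1) z₂ ++ R) := by
  obtain ⟨z₁, z₂, h1, h2, h3, h4, h5⟩ := h
  refine ⟨z₁, z₂, (cols X).drop β, ?_, ?_⟩
  · refine List.ext_getElem (by simp [cols]; omega) fun j hj _ => ?_
    simp only [cols, List.getElem_map, List.getElem_finRange, List.getElem_append,
      List.getElem_replicate, List.length_replicate, List.getElem_drop]
    have hj' : j < n := by simpa [cols] using hj
    split_ifs with c1 c2
    · funext i; exact h1 ⟨j, hj'⟩ (by simp only; omega) i
    · funext i; exact h2 ⟨j, hj'⟩ (by simp only; omega) (by simp only; omega) i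
    · funext i; congr 1; apply Fin.ext; simp; omega
  · refine List.ext_getElem (by simp [cols]; omega) fun j hj _ => ?_
    simp only [cols, List.getElem_map, List.getElem_finRange, List.getElem_append,
      List.getElem_replicate, List.length_replicate, List.getElem_drop]
    have hj' : j < n := by simpa [cols] using hj
    split_ifs with c1 c2
    · funext i; exact h3 ⟨j, hj'⟩ (by simp only; omega) i
    · funext i; exact h4 ⟨j, hj'⟩ (by simp only; omega) (by simp only; omega) i
    · funext i
      refine (h5 ⟨j, hj'⟩ (by simp only; omega) i).symm.trans ?_
      congr 1; apply Fin.ext; simp; omega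

theorem Similar.sameSums {p q : ℕ} (hp : 1 ≤ p) (hq : emin q ≤ emax q) {a n α β : ℕ}
    {X Y : Mat a n} (hα : 3 * 2 ^ p ≤ α) (hβ : α + 6 * 2 ^ p ≤ β) (hn : β ≤ n)
    (h : Similar α β X Y) : SameSums p q X Y := by
  have hP := pow_pos (zero_lt_two' ℕ) p
  obtain ⟨z₁, z₂, R, hX, hY⟩ := h.exists_cols (by omega) (by omega) hn
  have hmap : ∀ (Z : Mat a n) (g : (Fin a → EF) → EF),
      (List.finRange n).map (fun j => g fun i => Z i j) = (cols Z).map g := fun Z g => by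
    simp [cols]
  refine ⟨fun g hg => ?_, fun g => ?_⟩
  · simp only [fsum, hmap, hX, hY, List.map_append, List.map_replicate]
    exact fsuml_shift hp hq (hg _) (hg _) (by simp; intro z _; exact hg z) (by omega) (by omega)
  · simp only [vmax, hmap, hX, hY, List.map_append, List.map_replicate]
    exact foldl_emax2_shift (by omega) (by omega) _

/-- Applying one function to all columns preserves similarity. -/
theorem Similar.map {a b n α β : ℕ} {X Y : Mat a n} (h : Similar α β X Y)
    (F : (Fin a → EF) → Fin b → EF) :
    Similar α β (fun i j => F (fun i => X i j) i : Mat b n) (fun i j => F (fun i => Y i j) i) := by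
  obtain ⟨z₁, z₂, h1, h2, h3, h4, h5⟩ := h
  refine ⟨F z₁, F z₂, fun j hj i => ?_, fun j hj hj' i => ?_, fun j hj i => ?_,
    fun j hj hj' i => ?_, fun j hj i => ?_⟩
  · exact congrFun (congrArg F (funext (h1 j hj))) i
  · exact congrFun (congrArg F (funext (h2 j hj hj'))) i
  · exact congrFun (congrArg F (funext (h3 j hj))) i
  · exact congrFun (congrArg F (funext (h4 j hj hj'))) i
  · exact congrFun (congrArg F (funext (h5 j hj))) i

/-- Floating-point matrix-vector product. -/
def mulVec (p q : ℕ) {a b : ℕ} (W : Fin b → Fin a → ℝ) (z : Fin a → EF) : Fin b → EF :=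
  fun i => fsum p q fun j => fmul p q (.fin (W i j)) (z j)

/-- Attention score of a key column `x` against a query column `z`. -/
def score (p q : ℕ) {h m r d : ℕ} (B : Block h m r d) (i : Fin h) (x z : Fin d → EF) : EF :=
  fsum p q fun v => fmul p q (mulVec p q (B.WK i) x v) (mulVec p q (B.WQ i) z v)

/-- Output column of the attention layer for the query column `z` in the context `X`. -/
def attnColumn (p q : ℕ) {h m r d n : ℕ} (B : Block h m r d) (X : Mat d n) (z : Fin d → EF) :
    Fin d → EF := fun a =>
  fadd p q (z a) (fsum p q fun i => mulVec p q (B.WO i) (fun v => fsum p q fun u =>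
    fmul p q (mulVec p q (B.WV i) (fun k => X k u) v)
      (fdiv p q
        (fexp p q (fsub p q (score p q B i (fun k => X k u) z)
          (vmax fun u => score p q B i (fun k => X k u) z)))
        (fsum p q fun u => fexp p q (fsub p q (score p q B i (fun k => X k u) z)
          (vmax fun u => score p q B i (fun k => X k u) z))))) a)

theorem attnApply_eq (p q : ℕ) {h m r d n : ℕ} (B : Block h m r d) (X : Mat d n) :
    attnApply p q B X = fun a j => attnColumn p q B X (fun k => X k j) a := rfl

theorem SameSums.attnColumn_eq {p q : ℕ} (hp : 1 ≤ p) (hq : emin q ≤ emax q) {h m r d n : ℕ}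
    {X Y : Mat d n} (hXY : SameSums p q X Y) (B : Block h m r d) :
    attnColumn p q B X = attnColumn p q B Y := by
  funext z a
  unfold attnColumn
  have hmax : ∀ i, (vmax fun u => score p q B i (fun k => X k u) z) =
      vmax fun u => score p q B i (fun k => Y k u) z :=
    fun i => hXY.2 fun x => score p q B i x z
  have hden : ∀ i M, (fsum p q fun u => fexp p q (fsub p q (score p q B i (fun k => X k u) z) M)) =
      fsum p q fun u => fexp p q (fsub p q (score p q B i (fun k => Y k u) z) M) :=
    fun i M => hXY.1 (fun x => fexp p q (fsub p q (score p q B i x z) M))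
      fun _ => valid_fexp hp hq _
  have hnum : ∀ i v M D, (fsum p q fun u => fmul p q (mulVec p q (B.WV i) (fun k => X k u) v)
        (fdiv p q (fexp p q (fsub p q (score p q B i (fun k => X k u) z) M)) D)) =
      fsum p q fun u => fmul p q (mulVec p q (B.WV i) (fun k => Y k u) v)
        (fdiv p q (fexp p q (fsub p q (score p q B i (fun k => Y k u) z) M)) D) :=
    fun i v M D => hXY.1 (fun x => fmul p q (mulVec p q (B.WV i) x v)
        (fdiv p q (fexp p q (fsub p q (score p q B i x z) M)) D))
      fun _ => valid_fmul hp hq _ _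
  simp only [hmax, hden, hnum]

theorem Similar.blockApply {p q : ℕ} (hp : 1 ≤ p) (hq : emin q ≤ emax q) {h m r d n α β : ℕ}
    {X Y : Mat d n} (hα : 3 * 2 ^ p ≤ α) (hβ : α + 6 * 2 ^ p ≤ β) (hn : β ≤ n)
    (hXY : Similar α β X Y) (B : Block h m r d) :
    Similar α β (B.apply p q X) (B.apply p q Y) := by
  have hattn : Similar α β (attnApply p q B X) (attnApply p q B Y) := by
    rw [attnApply_eq, attnApply_eq, (hXY.sameSums hp hq hα hβ hn).attnColumn_eq hp hq B]
    exact hXY.map (attnColumn p q B Y)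
  exact hattn.map fun z a => fadd p q (z a) (fadd p q
    (fsum p q fun j => fmul p q (.fin (B.W2 a j))
      (frelu p q (fadd p q (mulVec p q B.W1 z j) (.fin (B.b1 j)))))
    (.fin (B.b2 a)))

theorem Similar.blocksApply {p q : ℕ} (hp : 1 ≤ p) (hq : emin q ≤ emax q) {h m r d n α β : ℕ}
    (hα : 3 * 2 ^ p ≤ α) (hβ : α + 6 * 2 ^ p ≤ β) (hn : β ≤ n) (L : List (Block h m r d))
    {X Y : Mat d n} (hXY : Similar α β X Y) :
    Similar α β (blocksApply p q L X) (blocksApply p q L Y) := by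
  induction L generalizing X Y with
  | nil => exact hXY
  | cons B L ih => exact ih (hXY.blockApply hp hq hα hβ hn B)

end

end FPT

/-- If `α ≥ 3·2^p`, `β − α ≥ 6·2^p`, `n ≥ β`, then floating-point
transformers map `(α,β)`-similar inputs to `(α,β)`-similar outputs. -/
theorem stmt1 (p q : ℕ) (hp : 2 ≤ p) (hpq : (p : ℤ) ≤ 2 ^ (q - 1) - 3)
    (din dout n α β : ℕ) (hdin : 0 < din) (hdout : 0 < dout)
    (hα : 3 * 2 ^ p ≤ α) (hβ : α + 6 * 2 ^ p ≤ β) (hn : β ≤ n)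
    (X Y : FPT.Mat din n) (hX : FPT.MatFin p q X) (hY : FPT.MatFin p q Y)
    (hsim : FPT.Similar α β X Y)
    (f : FPT.Mat din n → FPT.Mat dout n) (hf : FPT.IsTransformer p q din dout n f) :
    FPT.Similar α β (f X) (f Y) := by
  have hp' : 1 ≤ p := by omega
  have hq : FPT.emin q ≤ FPT.emax q := by
    unfold FPT.emin FPT.emax
    omega
  obtain ⟨h, m, r, d, L, Win, bin, Wout, bout, -, -, -, -, -, -, -, -, -, -, hf⟩ := hf
  rw [hf, hf]
  have hin := hsim.map fun z i => FPT.fadd p q (FPT.mulVec p q Win z i) (.fin (bin i))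
  exact (FPT.Similar.blocksApply hp' hq hα hβ hn L hin).map
    fun z i => FPT.fadd p q (FPT.mulVec p q Wout z i) (.fin (bout i))
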